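/- arXiv:1007.4294 — 4 statements merged into one kernel-verified Lean document; each statement's English description precedes it below -/
import Mathlib

section
/- There exists an optimal prefix-free machine. That is, there exists a partial recursive function U from finite binary strings to finite binary strings with prefix-free domain such that for every prefix-free machine C there is a constant d ∈ ℕ with the property that for every p in the domain of C there exists q with U(q) = C(p) and |q| ≤ |p| + d. -/
open scoped ENNReal

/-- A set of binary strings is prefix-free: no element is a proper prefix of another. -/
def PrefixFreeSet (S : Set (List Bool)) : Prop :=
  ∀ p ∈ S, ∀ q ∈ S, p <+: q → p = q

/-- A prefix-free machine: a partial recursive function on binary strings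
whose domain is a prefix-free set. -/
def PFMachine (C : List Bool →. List Bool) : Prop :=
  Partrec C ∧ PrefixFreeSet C.Dom

/-- `Hm C s` is the length of a shortest program `p` with `C p = s` (`∞` if none). -/
noncomputable def Hm (C : List Bool →. List Bool) (s : List Bool) : ℕ∞ :=
  sInf ((fun p : List Bool => (p.length : ℕ∞)) '' {p | s ∈ C p})

/-- An optimal prefix-free machine: for every prefix-free machine `C` there is `d ∈ ℕ`
such that every `p ∈ dom C` has a `q` with `U q = C p` and `|q| ≤ |p| + d`. -/
def OptimalPFM (U : List Bool →. List Bool) : Prop :=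
  PFMachine U ∧ ∀ C : List Bool →. List Bool, PFMachine C →
    ∃ d : ℕ, ∀ p s, s ∈ C p → ∃ q : List Bool, s ∈ U q ∧ q.length ≤ p.length + d

/-- The binary string identified with `n : ℕ` via `φ(s) = (the dyadic integer 1s) − 1`. -/
def strOfNat (n : ℕ) : List Bool := ((n + 1).bits.dropLast).reverse

open Encodable Nat.Partrec

/-- The self-delimiting tag of a code, followed by a string. -/
def tagged (n : ℕ) (r : List Bool) : List Bool :=
  (List.range n).map (fun _ => true) ++ false :: r

theorem tagged_length (n : ℕ) (r : List Bool) : (tagged n r).length = r.length + (n + 1) := by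
  simp [tagged]; omega

theorem tagged_zero (r : List Bool) : tagged 0 r = false :: r := by simp [tagged]

theorem tagged_succ (n : ℕ) (r : List Bool) : tagged (n + 1) r = true :: tagged n r := by
  simp [tagged, List.map_const', List.replicate_succ]

theorem tagged_prefix : ∀ {n m : ℕ} {r s : List Bool}, tagged n r <+: tagged m s →
    n = m ∧ r <+: s
  | 0, 0, r, s, h => by simpa [tagged_zero] using h
  | 0, m + 1, r, s, h => by simp [tagged_zero, tagged_succ] at h
  | n + 1, 0, r, s, h => by simp [tagged_zero, tagged_succ] at h
  | n + 1, m + 1, r, s, h => by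
    rw [tagged_succ, tagged_succ, List.cons_prefix_cons] at h
    have := tagged_prefix h.2
    exact ⟨by rw [this.1], this.2⟩

theorem primrec_tagged : Primrec₂ tagged := by
  refine Primrec.list_append.comp
    (Primrec.list_map (Primrec.list_range.comp Primrec.fst) (Primrec.const true).to₂)
    (Primrec.list_cons.comp (Primrec.const false) Primrec.snd)

/-- Comparability of strings. -/
def cmpb (p q : List Bool) : Bool := decide (p.take q.length = q.take p.length)

theorem cmpb_iff (p q : List Bool) : cmpb p q = true ↔ p <+: q ∨ q <+: p := by
  unfold cmpb
  rw [decide_eq_true_iff]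
  constructor
  · intro h
    rcases le_total p.length q.length with hl | hl
    · left
      rw [List.take_of_length_le hl] at h
      rw [h]; exact List.take_prefix _ _
    · right
      rw [List.take_of_length_le hl] at h
      rw [← h]; exact List.take_prefix _ _
  · rintro (h | h)
    · rw [List.take_of_length_le h.length_le]
      exact List.prefix_iff_eq_take.1 h
    · rw [List.take_of_length_le h.length_le]
      exact (List.prefix_iff_eq_take.1 h).symm

theorem primrec_cmpb : Primrec₂ cmpb := by
  refine Primrec.eq.decide.comp
    (Primrec.list_take.comp ((Primrec.list_length (α := Bool)).comp Primrec.snd) Primrec.fst)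
    (Primrec.list_take.comp ((Primrec.list_length (α := Bool)).comp Primrec.fst) Primrec.snd)

/-- Stage `t` of the enumeration of all (tagged program, output) pairs. -/
def stepT (t : ℕ) : Option (List Bool × List Bool) :=
  (decode (α := (ℕ × Code) × List Bool) t).bind fun a =>
    ((Code.evaln a.1.1 a.1.2 (encode a.2)).bind fun y => decode (α := List Bool) y).map
      fun s => (tagged (encode a.1.2) a.2, s)

theorem primrec_stepT : Primrec stepT := by
  refine Primrec.option_bind Primrec.decode ?_
  have h2 : Primrec fun x : ℕ × ((ℕ × Code) × List Bool) => x.2 := Primrec.snd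
  refine Primrec.option_map (Primrec.option_bind ?_ ?_) ?_
  · exact Code.primrec_evaln.comp
      ((Primrec.fst.comp h2).pair (Primrec.encode.comp (Primrec.snd.comp h2)))
  · exact (Primrec.decode.comp Primrec.snd)
  · refine Primrec.pair ?_ Primrec.snd
    exact primrec_tagged.comp
      (Primrec.encode.comp (Primrec.snd.comp (Primrec.fst.comp (h2.comp Primrec.fst))))
      (Primrec.snd.comp (h2.comp Primrec.fst))

/-- Does stage `t` enumerate a string comparable with `w`? -/
def testT (w : List Bool) (t : ℕ) : Bool :=
  ((stepT t).map fun a => cmpb a.1 w).getD false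

/-- Output of stage `t` on `w`. -/
def outT (w : List Bool) (t : ℕ) : Option (List Bool) :=
  (stepT t).bind fun a => if a.1 = w then some a.2 else none

theorem primrec_testT : Primrec₂ testT := by
  refine Primrec.option_getD.comp (Primrec.option_map (primrec_stepT.comp Primrec.snd) ?_)
    (Primrec.const false)
  exact primrec_cmpb.comp (Primrec.fst.comp Primrec.snd) (Primrec.fst.comp Primrec.fst)

theorem primrec_outT : Primrec₂ outT := by
  refine Primrec.option_bind (primrec_stepT.comp Primrec.snd) ?_
  refine Primrec.ite ?_ (Primrec.option_some.comp (Primrec.snd.comp Primrec.snd))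
    (Primrec.const none)
  exact Primrec.eq.comp (Primrec.fst.comp Primrec.snd) (Primrec.fst.comp Primrec.fst)

/-- The universal machine. -/
def univM (w : List Bool) : Part (List Bool) :=
  (Nat.rfind fun t => Part.some (testT w t)).bind fun t => (outT w t : Part (List Bool))

theorem partrec_univM : Partrec univM := by
  refine Partrec.bind (Partrec.rfind ?_) (Computable.ofOption primrec_outT.to_comp)
  exact primrec_testT.to_comp.partrec

theorem mem_univM {w s : List Bool} : s ∈ univM w ↔
    ∃ t, stepT t = some (w, s) ∧ ∀ m < t, ∀ a, stepT m = some a → cmpb a.1 w = false := by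
  unfold univM
  rw [Part.mem_bind_iff]
  refine exists_congr fun t => ?_
  refine (and_congr_left' Nat.mem_rfind).trans ?_
  have hs : cmpb w w = true := (cmpb_iff _ _).2 (Or.inl (List.prefix_refl _))
  have key : ∀ m, (testT w m = false ↔ ∀ a, stepT m = some a → cmpb a.1 w = false) := by
    intro m
    unfold testT
    cases stepT m <;> simp
  have h3 : s ∈ (outT w t : Part (List Bool)) ↔ stepT t = some (w, s) := by
    rw [Part.mem_coe]
    unfold outT
    cases h : stepT t with
    | none => simp
    | some a => rcases a with ⟨a, b⟩; by_cases hw : a = w <;> simp [hw]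
  rw [h3]
  simp only [Part.mem_some_iff]
  constructor
  · rintro ⟨⟨_, h⟩, h'⟩
    exact ⟨h', fun m hm => (key m).1 (h hm).symm⟩
  · rintro ⟨h, h'⟩
    exact ⟨⟨by simp [testT, h, hs], fun {m} hm => ((key m).2 (h' m hm)).symm⟩, h⟩

theorem prefixFree_univM : PrefixFreeSet (PFun.Dom univM) := by
  intro p hp q hq hpq
  obtain ⟨s, hs⟩ := (PFun.mem_dom _ _).1 hp
  obtain ⟨u, hu⟩ := (PFun.mem_dom _ _).1 hq
  obtain ⟨t, h1, h2⟩ := mem_univM.1 hs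
  obtain ⟨t', h1', h2'⟩ := mem_univM.1 hu
  have c1 : cmpb p q = true := (cmpb_iff _ _).2 (Or.inl hpq)
  have c2 : cmpb q p = true := (cmpb_iff _ _).2 (Or.inr hpq)
  rcases lt_trichotomy t t' with h | h | h
  · have := h2' t h _ h1; simp_all
  · subst h; rw [h1] at h1'; simp at h1'; exact h1'.1
  · have := h2 t' h _ h1'; simp_all

/-- There exists an optimal prefix-free machine. -/
theorem exists_optimal_prefix_free_machine :
    ∃ U : List Bool →. List Bool, OptimalPFM U := by
  refine ⟨univM, ⟨partrec_univM, prefixFree_univM⟩, ?_⟩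
  rintro C ⟨hC, hpf⟩
  obtain ⟨c, hc⟩ := Code.exists_code.1 hC
  refine ⟨encode c + 1, fun p s hs => ⟨tagged (encode c) p, ?_, (tagged_length _ _).le⟩⟩
  have hev : ∀ r : List Bool, Code.eval c (encode r) = (C r).map encode := by
    intro r; rw [hc]; simp
  -- every enumerated pair comparable with the tagged program is the right one
  have huniq : ∀ m a, stepT m = some a → cmpb a.1 (tagged (encode c) p) = true →
      a = (tagged (encode c) p, s) := by
    intro m a hm hcmp
    unfold stepT at hm
    simp only [Option.bind_eq_some_iff, Option.map_eq_some_iff] at hm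
    obtain ⟨⟨⟨k, c'⟩, r⟩, -, u, ⟨y, hy, hu⟩, rfl⟩ := hm
    have hcc : c' = c ∧ (r <+: p ∨ p <+: r) := by
      rcases (cmpb_iff _ _).1 hcmp with h | h
      · have := tagged_prefix h
        exact ⟨encode_injective this.1, Or.inl this.2⟩
      · have := tagged_prefix h
        exact ⟨(encode_injective this.1).symm, Or.inr this.2⟩
    obtain ⟨rfl, hrp⟩ := hcc
    have hy' := Code.evaln_sound hy
    rw [hev] at hy'
    obtain ⟨v, hv, rfl⟩ := (Part.mem_map_iff _).1 hy'
    have hrp' : r = p := by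
      have hr : r ∈ PFun.Dom C := (PFun.mem_dom _ _).2 ⟨v, hv⟩
      have hp : p ∈ PFun.Dom C := (PFun.mem_dom _ _).2 ⟨s, hs⟩
      rcases hrp with h | h
      · exact hpf _ hr _ hp h
      · exact (hpf _ hp _ hr h).symm
    subst hrp'
    have hvs := Part.mem_unique hv hs
    subst hvs
    simp at hu
    simp [hu]
  have hex : ∃ t, stepT t = some (tagged (encode c) p, s) := by
    have : encode s ∈ Code.eval c (encode p) := by
      rw [hev]; exact Part.mem_map _ hs
    obtain ⟨k, hk⟩ := Code.evaln_complete.1 this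
    refine ⟨encode ((k, c), p), ?_⟩
    unfold stepT
    rw [Option.mem_def] at hk
    rw [encodek]
    simp [hk]
  classical
  refine mem_univM.2 ⟨Nat.find hex, Nat.find_spec hex, fun m hm a ha => ?_⟩
  by_contra hne
  have h := huniq m a ha (by simpa using hne)
  exact Nat.find_min hex hm (h ▸ ha)
end

section
/- For every optimal prefix-free machine V there exists an optimal prefix-free machine W such that: (i) H_W(s) = H_V(s) for every finite binary string s; and (ii) W⁻¹(s) = {p : W(p) = s} is an infinite set for every finite binary string s. -/
open scoped ENNReal

/-- The unary code of `n`. -/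
def unaryCode (n : ℕ) : List Bool := (List.range n).map (fun _ => true) ++ [false]

theorem unaryCode_zero : unaryCode 0 = [false] := rfl

theorem unaryCode_succ (n : ℕ) : unaryCode (n + 1) = true :: unaryCode n := by
  simp [unaryCode, List.replicate_succ]

theorem unaryCode_length (n : ℕ) : (unaryCode n).length = n + 1 := by
  simp [unaryCode]

theorem unaryCode_prefix : ∀ m n : ℕ, unaryCode m <+: unaryCode n → m = n
  | 0, 0, _ => rfl
  | 0, n + 1, h => by
    rw [unaryCode_zero, unaryCode_succ, List.cons_prefix_cons] at h
    simp at h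
  | m + 1, 0, h => by
    rw [unaryCode_zero, unaryCode_succ, List.cons_prefix_cons] at h
    simp at h
  | m + 1, n + 1, h => by
    rw [unaryCode_succ, unaryCode_succ, List.cons_prefix_cons] at h
    rw [unaryCode_prefix m n h.2]

theorem unaryCode_primrec : Primrec unaryCode :=
  Primrec.list_append.comp
    (Primrec.list_map Primrec.list_range (Primrec.const true).to₂) (Primrec.const [false])

/-- Replace the program `p0` by the programs `p0 ++ unaryCode m`, with outputs `g m`. -/
def graft (V : List Bool →. List Bool) (p0 : List Bool) (g : ℕ →. List Bool) :
    List Bool →. List Bool := fun q =>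
  bif decide (q = p0 ++ unaryCode (q.length - (p0.length + 1))) then
    g (q.length - (p0.length + 1))
  else bif decide (q = p0) then Part.none else V q

theorem graft_partrec {V : List Bool →. List Bool} {p0 : List Bool} {g : ℕ →. List Bool}
    (hV : Partrec V) (hg : Partrec g) : Partrec (graft V p0 g) := by
  have hl : Primrec fun q : List Bool => q.length - (p0.length + 1) :=
    Primrec.nat_sub.comp Primrec.list_length (Primrec.const _)
  have h1 : Primrec fun q : List Bool =>
      decide (q = p0 ++ unaryCode (q.length - (p0.length + 1))) :=
    (Primrec.eq.comp Primrec.id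
      (Primrec.list_append.comp (Primrec.const p0) (unaryCode_primrec.comp hl))).decide
  have h2 : Primrec fun q : List Bool => decide (q = p0) :=
    (Primrec.eq.comp Primrec.id (Primrec.const p0)).decide
  exact Partrec.cond h1.to_comp (hg.comp hl.to_comp) (Partrec.cond h2.to_comp Partrec.none hV)

theorem mem_graft_code {V : List Bool →. List Bool} {p0 : List Bool} {g : ℕ →. List Bool}
    (m : ℕ) (s : List Bool) : s ∈ graft V p0 g (p0 ++ unaryCode m) ↔ s ∈ g m := by
  have : (p0 ++ unaryCode m).length - (p0.length + 1) = m := by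
    simp [unaryCode_length]; omega
  unfold graft
  rw [this]
  simp

theorem mem_graft {V : List Bool →. List Bool} {p0 : List Bool} {g : ℕ →. List Bool}
    {q s : List Bool} (h : s ∈ graft V p0 g q) :
    (∃ m, q = p0 ++ unaryCode m ∧ s ∈ g m) ∨ (q ≠ p0 ∧ s ∈ V q) := by
  by_cases h1 : q = p0 ++ unaryCode (q.length - (p0.length + 1))
  · left
    refine ⟨_, h1, ?_⟩
    rw [h1, mem_graft_code] at h
    exact h
  · right
    unfold graft at h
    rw [decide_eq_false h1] at h
    by_cases h2 : q = p0
    · simp [h2] at h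
    · simpa [h2] using h

theorem mem_graft_old {V : List Bool →. List Bool} {p0 : List Bool} {g : ℕ →. List Bool}
    {q s : List Bool} (hs : s ∈ V q) (h : ¬ p0 <+: q) : s ∈ graft V p0 g q := by
  have h1 : ¬ q = p0 ++ unaryCode (q.length - (p0.length + 1)) := by
    intro h1
    exact h ⟨_, h1.symm⟩
  have h2 : ¬ q = p0 := by
    rintro rfl
    exact h List.prefix_rfl
  unfold graft
  rw [decide_eq_false h1, decide_eq_false h2]
  exact hs

theorem graft_pfm {V : List Bool →. List Bool} {p0 : List Bool} {g : ℕ →. List Bool}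
    (hV : PFMachine V) (hg : Partrec g)
    (hp : ∀ q ∈ V.Dom, q ≠ p0 → ¬ p0 <+: q ∧ ¬ q <+: p0) : PFMachine (graft V p0 g) := by
  refine ⟨graft_partrec hV.1 hg, ?_⟩
  intro p hpd q hqd hpq
  obtain ⟨s, hs⟩ := (PFun.mem_dom _ _).1 hpd
  obtain ⟨t, ht⟩ := (PFun.mem_dom _ _).1 hqd
  rcases mem_graft hs with ⟨m, rfl, -⟩ | ⟨hne, hs'⟩ <;>
    rcases mem_graft ht with ⟨n, rfl, -⟩ | ⟨hne', ht'⟩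
  · rw [List.prefix_append_right_inj] at hpq
    rw [unaryCode_prefix _ _ hpq]
  · exact absurd ((List.prefix_append _ _).trans hpq)
      (hp q ((PFun.mem_dom _ _).2 ⟨t, ht'⟩) hne').1
  · have := hp p ((PFun.mem_dom _ _).2 ⟨s, hs'⟩) hne
    rcases List.prefix_or_prefix_of_prefix hpq (List.prefix_append p0 (unaryCode n)) with h | h
    · exact absurd h this.2
    · exact absurd h this.1
  · exact hV.2 p ((PFun.mem_dom _ _).2 ⟨s, hs'⟩) q ((PFun.mem_dom _ _).2 ⟨t, ht'⟩) hpq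

/-- An optimal machine is within a constant of any machine with unary programs. -/
theorem optimal_unary {V : List Bool →. List Bool} (hV : OptimalPFM V) {g : ℕ →. List Bool}
    (hg : Partrec g) :
    ∃ d : ℕ, ∀ m s, s ∈ g m → ∃ q, s ∈ V q ∧ q.length ≤ m + 1 + d := by
  have h0 : PFMachine (fun _ => Part.none : List Bool →. List Bool) := by
    refine ⟨Partrec.none, ?_⟩
    intro p hp
    obtain ⟨s, hs⟩ := (PFun.mem_dom _ _).1 hp
    exact absurd hs (Part.notMem_none _)
  obtain ⟨d, hd⟩ := hV.2 (graft (fun _ => Part.none) [] g) (graft_pfm h0 hg (by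
    intro q hq
    obtain ⟨s, hs⟩ := (PFun.mem_dom _ _).1 hq
    exact absurd hs (Part.notMem_none _)))
  refine ⟨d, fun m s hs => ?_⟩
  obtain ⟨q, hq, hl⟩ := hd ([] ++ unaryCode m) s ((mem_graft_code m s).2 hs)
  refine ⟨q, hq, ?_⟩
  simpa [unaryCode_length] using hl

/-- Searching for a long program: effectively. -/
theorem exists_search {V : List Bool →. List Bool} (hV : Partrec V) :
    ∃ g : ℕ →. List Bool, Partrec g ∧
      (∀ k s, s ∈ g k → ∃ p, 2 * k ≤ p.length ∧ s ∈ V p) ∧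
      (∀ k p, 2 * k ≤ p.length → p ∈ V.Dom → (g k).Dom) := by
  obtain ⟨c, hc⟩ := Nat.Partrec.Code.exists_code.1 hV
  have hmem : ∀ p s, s ∈ V p ↔ ∃ x ∈ c.eval (Encodable.encode p), Encodable.decode x = some s := by
    intro p s
    rw [hc]
    simp
  let f : ℕ → ℕ → Option (List Bool) := fun k n =>
    (Encodable.decode (α := List Bool) n.unpair.1).bind fun p =>
      bif decide (2 * k ≤ p.length) then
        (Nat.Partrec.Code.evaln n.unpair.2 c (Encodable.encode p)).bind
          (fun x => Encodable.decode (α := List Bool) x)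
      else none
  have hf : Computable₂ f := by
    apply Primrec.to_comp
    refine Primrec.option_bind
      (Primrec.decode.comp (Primrec.fst.comp (Primrec.unpair.comp Primrec.snd))) ?_
    refine Primrec.cond ?_ ?_ (Primrec.const none)
    · exact (Primrec.nat_le.comp
        (Primrec.nat_mul.comp (Primrec.const 2) (Primrec.fst.comp Primrec.fst))
        (Primrec.list_length.comp Primrec.snd)).decide
    · refine Primrec.option_bind ?_ (Primrec.decode.comp Primrec.snd)
      exact Nat.Partrec.Code.primrec_evaln.comp
        (((Primrec.snd.comp (Primrec.unpair.comp (Primrec.snd.comp Primrec.fst))).pair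
          (Primrec.const c)).pair (Primrec.encode.comp Primrec.snd))
  refine ⟨fun k => Nat.rfindOpt (f k), Partrec.rfindOpt hf, ?_, ?_⟩
  · intro k s hs
    obtain ⟨n, hn⟩ := Nat.rfindOpt_spec hs
    simp only [f, Option.mem_def, Option.bind_eq_some_iff] at hn
    obtain ⟨p, -, hn⟩ := hn
    by_cases h : 2 * k ≤ p.length
    · simp only [h, decide_true, cond_true, Option.bind_eq_some_iff] at hn
      obtain ⟨x, hx, hxs⟩ := hn
      exact ⟨p, h, (hmem p s).2 ⟨x, Nat.Partrec.Code.evaln_sound hx, hxs⟩⟩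
    · simp [h] at hn
  · intro k p hk hp
    obtain ⟨s, hs⟩ := (PFun.mem_dom _ _).1 hp
    obtain ⟨x, hx, hxs⟩ := (hmem p s).1 hs
    obtain ⟨t, ht⟩ := Nat.Partrec.Code.evaln_complete.1 hx
    rw [Option.mem_def] at ht
    refine Nat.rfindOpt_dom.2 ⟨Nat.pair (Encodable.encode p) t, s, ?_⟩
    simp [f, hk, ht, hxs]

theorem optimal_decode {V : List Bool →. List Bool} (hV : OptimalPFM V) :
    ∃ d : ℕ, ∀ s : List Bool, ∃ q, s ∈ V q ∧ q.length ≤ Encodable.encode s + 1 + d := by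
  have hg : Partrec (fun m : ℕ => (Encodable.decode (α := List Bool) m : Part (List Bool))) :=
    Computable.ofOption Primrec.decode.to_comp
  obtain ⟨d, hd⟩ := optimal_unary hV hg
  exact ⟨d, fun s => hd (Encodable.encode s) s (by simp)⟩

theorem exists_long {V : List Bool →. List Bool} (hV : OptimalPFM V) (k : ℕ) :
    ∃ p ∈ V.Dom, k ≤ p.length := by
  by_contra! hcon
  obtain ⟨d, hd⟩ := optimal_decode hV
  choose q hq _ using hd
  have hinj : Function.Injective q := by
    intro s t hst
    have h1 := hq s
    rw [hst] at h1
    exact Part.mem_unique h1 (hq t)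
  have hfin : {l : List Bool | l.length < k}.Finite := List.finite_length_lt Bool k
  refine Set.infinite_of_injective_forall_mem hinj (s := {l : List Bool | l.length < k}) ?_ hfin
  intro s
  exact hcon _ ((PFun.mem_dom _ _).2 ⟨s, hq s⟩)

/-- An optimal machine is not injective. -/
theorem exists_redundant {V : List Bool →. List Bool} (hV : OptimalPFM V) :
    ∃ p0 p1 s, s ∈ V p0 ∧ s ∈ V p1 ∧ p1 ≠ p0 ∧ p1.length ≤ p0.length := by
  obtain ⟨g, hg, hg1, hg2⟩ := exists_search hV.1.1
  obtain ⟨d, hd⟩ := optimal_unary hV hg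
  obtain ⟨p, hp, hl⟩ := exists_long hV (2 * (d + 2))
  have hdom := hg2 (d + 2) p hl hp
  have hs := Part.get_mem hdom
  obtain ⟨p0, h0, hs0⟩ := hg1 _ _ hs
  obtain ⟨p1, hs1, h1⟩ := hd _ _ hs
  refine ⟨p0, p1, _, hs0, hs1, ?_, by omega⟩
  rintro rfl
  omega

theorem Hm_le_of_dom {V W : List Bool →. List Bool} {s : List Bool}
    (h : ∀ p, s ∈ V p → ∃ q, s ∈ W q ∧ q.length ≤ p.length) : Hm W s ≤ Hm V s := by
  refine le_sInf ?_
  rintro _ ⟨p, hp, rfl⟩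
  obtain ⟨q, hq, hl⟩ := h p hp
  have h1 : Hm W s ≤ (q.length : ℕ∞) := sInf_le ⟨q, hq, rfl⟩
  have h2 : (q.length : ℕ∞) ≤ (p.length : ℕ∞) := by exact_mod_cast hl
  exact h1.trans h2

/-- For every optimal prefix-free machine `V` there is an optimal prefix-free machine `W` with
(i) `H_W = H_V` and (ii) every `W⁻¹(s)` infinite. -/
theorem exists_optimal_machine_infinite_fibers (V : List Bool →. List Bool)
    (hV : OptimalPFM V) :
    ∃ W : List Bool →. List Bool, OptimalPFM W ∧
      (∀ s, Hm W s = Hm V s) ∧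
      (∀ s, {p : List Bool | s ∈ W p}.Infinite) := by
  obtain ⟨p0, p1, s0, hs0, hs1, hne, hlen⟩ := exists_redundant hV
  obtain ⟨d, hd⟩ := optimal_decode hV
  have hd0 : p0 ∈ V.Dom := (PFun.mem_dom _ _).2 ⟨s0, hs0⟩
  have hpf : ∀ q ∈ V.Dom, q ≠ p0 → ¬ p0 <+: q ∧ ¬ q <+: p0 := by
    intro q hq hqne
    exact ⟨fun h => hqne (hV.1.2 p0 hd0 q hq h).symm, fun h => hqne (hV.1.2 q hq p0 hd0 h)⟩
  let go : ℕ → Option (List Bool) := fun m =>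
    (Encodable.decode (α := List Bool) (m - d).unpair.2).bind fun s =>
      bif decide (d + Encodable.encode s ≤ m) then some s else none
  have hgo : Primrec go := by
    refine Primrec.option_bind (Primrec.decode.comp (Primrec.snd.comp (Primrec.unpair.comp
      (Primrec.nat_sub.comp Primrec.id (Primrec.const d))))) ?_
    refine Primrec.cond ?_ (Primrec.option_some.comp Primrec.snd) (Primrec.const none)
    exact (Primrec.nat_le.comp (Primrec.nat_add.comp (Primrec.const d)
      (Primrec.encode.comp Primrec.snd)) Primrec.fst).decide
  let g : ℕ →. List Bool := fun m => (go m : Part (List Bool))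
  have hg : Partrec g := Computable.ofOption hgo.to_comp
  have hgs : ∀ n s, s ∈ g (d + Nat.pair n (Encodable.encode s)) := by
    intro n s
    simp [g, go, Nat.right_le_pair]
  have hVW : ∀ s p, s ∈ V p → ∃ q, s ∈ graft V p0 g q ∧ q.length ≤ p.length := by
    intro s p hp
    by_cases h : p = p0
    · subst h
      have : s = s0 := Part.mem_unique hp hs0
      subst this
      exact ⟨p1, mem_graft_old hs1 (hpf p1 ((PFun.mem_dom _ _).2 ⟨_, hs1⟩) hne).1, hlen⟩
    · exact ⟨p, mem_graft_old hp (hpf p ((PFun.mem_dom _ _).2 ⟨_, hp⟩) h).1, le_rfl⟩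
  have hWV : ∀ s p, s ∈ graft V p0 g p → ∃ q, s ∈ V q ∧ q.length ≤ p.length := by
    intro s p hp
    rcases mem_graft hp with ⟨m, rfl, hm⟩ | ⟨-, h⟩
    · obtain ⟨q, hq, hl⟩ := hd s
      refine ⟨q, hq, hl.trans ?_⟩
      simp only [g, go, Part.mem_ofOption, Option.mem_def, Option.bind_eq_some_iff] at hm
      obtain ⟨t, -, ht⟩ := hm
      by_cases hdm : d + Encodable.encode t ≤ m
      · simp only [hdm, decide_true, cond_true, Option.some.injEq] at ht
        subst ht
        rw [List.length_append, unaryCode_length]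
        omega
      · simp [hdm] at ht
    · exact ⟨p, h, le_rfl⟩
  refine ⟨graft V p0 g, ⟨graft_pfm hV.1 hg hpf, ?_⟩, ?_, ?_⟩
  · intro C hC
    obtain ⟨e, he⟩ := hV.2 C hC
    refine ⟨e, fun p s hs => ?_⟩
    obtain ⟨q, hq, hl⟩ := he p s hs
    obtain ⟨r, hr, hl'⟩ := hVW s q hq
    exact ⟨r, hr, hl'.trans hl⟩
  · intro s
    exact le_antisymm (Hm_le_of_dom (hVW s)) (Hm_le_of_dom (hWV s))
  · intro s
    refine Set.infinite_of_injective_forall_mem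
      (f := fun n => p0 ++ unaryCode (d + Nat.pair n (Encodable.encode s))) ?_ ?_
    · intro m n h
      have h0 := List.append_cancel_left h
      have h' := unaryCode_prefix _ _ (h0 ▸ List.prefix_rfl :
        unaryCode (d + Nat.pair m (Encodable.encode s)) <+:
          unaryCode (d + Nat.pair n (Encodable.encode s)))
      have := Nat.add_left_cancel h'
      exact (Nat.pair_eq_pair.1 this).1
    · intro n
      exact (mem_graft_code _ _).2 (hgs n s)
end

section
/- Let U be an optimal prefix-free machine (defining H = H_U) and let V be any optimal prefix-free machine. Then #{p ∈ {0,1}* : |p| ≤ n and p ∈ dom V} = 2^{n − H(n) + O(1)}; precisely, there exists d ∈ ℕ such that (i) #{p : |p| ≤ n and p ∈ dom V} ≤ 2^{n − H(n) + d} for all n ∈ ℕ, and (ii) 2^{n − H(n) − d} ≤ #{p : |p| ≤ n and p ∈ dom V} for all n ∈ ℕ with n − H(n) ≥ d. Here n ∈ ℕ is identified with a finite binary string via the bijection φ(s) = (the dyadic integer 1s) − 1. -/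
open scoped ENNReal

/-- Value of the binary string `1s`. -/
def val1 (s : List Bool) : ℕ := s.foldl (fun a b => 2 * a + b.toNat) 1

/-- Value of the binary string `s`. -/
def val0 (s : List Bool) : ℕ := s.foldl (fun a b => 2 * a + b.toNat) 0

theorem primrec_foldstep (c : ℕ) :
    Primrec (fun s : List Bool => s.foldl (fun a b => 2 * a + b.toNat) c) := by
  have h : Primrec₂ (fun (_ : List Bool) (x : ℕ × Bool) => 2 * x.1 + x.2.toNat) :=
    Primrec.nat_add.comp
      (Primrec.nat_mul.comp (Primrec.const 2) (Primrec.fst.comp Primrec.snd))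
      ((Primrec.dom_bool Bool.toNat).comp (Primrec.snd.comp Primrec.snd))
  exact Primrec.list_foldl Primrec.id (Primrec.const c) h

theorem primrec_val1 : Primrec val1 := primrec_foldstep 1
theorem primrec_val0 : Primrec val0 := primrec_foldstep 0

theorem foldr_pos (l : List Bool) : 1 ≤ l.foldr (fun b a => 2 * a + b.toNat) 1 := by
  induction l with
  | nil => simp
  | cons b l ih => simp only [List.foldr_cons]; omega

theorem foldr_inj : ∀ l l' : List Bool, l.foldr (fun b a => 2 * a + b.toNat) 1 =
    l'.foldr (fun b a => 2 * a + b.toNat) 1 → l = l'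
  | [], [], _ => rfl
  | [], b :: l, h => by
    have := foldr_pos l
    simp only [List.foldr_cons, List.foldr_nil] at h; omega
  | b :: l, [], h => by
    have := foldr_pos l
    simp only [List.foldr_cons, List.foldr_nil] at h; omega
  | b :: l, b' :: l', h => by
    simp only [List.foldr_cons] at h
    have e : b = b' := by
      cases b <;> cases b' <;> simp at h ⊢ <;> omega
    subst e
    rw [foldr_inj l l' (by omega)]

theorem val1_inj {s t : List Bool} (h : val1 s = val1 t) : s = t := by
  have := foldr_inj s.reverse t.reverse (by simpa [val1] using h)
  simpa using this

theorem foldr_bits : ∀ n : ℕ, n ≠ 0 → n.bits.dropLast.foldr (fun b a => 2 * a + b.toNat) 1 = n := by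
  intro n
  induction n using Nat.binaryRec' with
  | zero => simp
  | bit b n h ih =>
    intro _
    rw [Nat.bits_append_bit n b h]
    by_cases hn : n = 0
    · subst hn
      have := h rfl
      subst this
      simp
    · have h2 : n.bits ≠ [] := by
        intro h3
        apply hn
        have h4 := Nat.size_eq_bits_len n
        rw [h3] at h4
        exact Nat.size_eq_zero.1 h4.symm
      rw [List.dropLast_cons_of_ne_nil h2, List.foldr_cons, ih hn, Nat.bit_val]

theorem val1_strOfNat (n : ℕ) : val1 (strOfNat n) = n + 1 := by
  simpa [val1, strOfNat] using foldr_bits (n + 1) (by omega)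

theorem strOfNat_inj {m n : ℕ} (h : strOfNat m = strOfNat n) : m = n := by
  have := congrArg val1 h
  simp only [val1_strOfNat] at this; omega

theorem computable_strOfNat : Computable strOfNat := by
  have h : Computable₂ (fun (n k : ℕ) =>
      (Encodable.decode (α := List Bool) k).bind
        (fun s => bif val1 s == n + 1 then some s else none)) := by
    apply Primrec₂.to_comp
    refine Primrec.option_bind (Primrec.decode.comp Primrec.snd) ?_
    refine Primrec.cond (Primrec.beq.comp (primrec_val1.comp Primrec.snd)
      (Primrec.succ.comp (Primrec.fst.comp Primrec.fst))) (Primrec.option_some.comp Primrec.snd)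
      (Primrec.const none)
  refine (Partrec.rfindOpt h).of_eq_tot fun n => ?_
  have hd : (Nat.rfindOpt fun k => (Encodable.decode (α := List Bool) k).bind
        (fun s => bif val1 s == n + 1 then some s else none)).Dom := by
    rw [Nat.rfindOpt_dom]
    refine ⟨Encodable.encode (strOfNat n), strOfNat n, ?_⟩
    simp [val1_strOfNat]
  obtain ⟨s, hs⟩ := Part.dom_iff_mem.1 hd
  obtain ⟨k, hk⟩ := Nat.rfindOpt_spec hs
  have : s = strOfNat n := by
    apply val1_inj
    rw [val1_strOfNat]
    simp only [Option.mem_def, Option.bind_eq_some_iff] at hk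
    obtain ⟨a, _, h2⟩ := hk
    by_cases h3 : val1 a = n + 1
    · simp [h3] at h2; rw [← h2, h3]
    · have h4 : (val1 a == n + 1) = false := by simpa using h3
      simp [h4] at h2
  rwa [← this]

theorem exists_step {f : List Bool →. List Bool} (hf : Partrec f) :
    ∃ u : ℕ → List Bool → Option (List Bool), Primrec₂ u ∧ (∀ p, u 0 p = none) ∧
      (∀ t t' p s, t ≤ t' → u t p = some s → u t' p = some s) ∧
      (∀ p s, s ∈ f p ↔ ∃ t, u t p = some s) := by
  obtain ⟨c, hc⟩ := Nat.Partrec.Code.exists_code.1 hf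
  refine ⟨fun t p => (c.evaln t (Encodable.encode p)).bind Encodable.decode, ?_, ?_, ?_, ?_⟩
  · refine Primrec.option_bind ?_ (Primrec.decode.comp Primrec.snd)
    exact Nat.Partrec.Code.primrec_evaln.comp
      ((Primrec.fst.pair (Primrec.const c)).pair (Primrec.encode.comp Primrec.snd))
  · intro p; simp [Nat.Partrec.Code.evaln]
  · intro t t' p s htt h
    simp only [Option.bind_eq_some_iff] at h ⊢
    obtain ⟨a, h1, h2⟩ := h
    exact ⟨a, Nat.Partrec.Code.evaln_mono htt h1, h2⟩
  · intro p s
    have key : c.eval (Encodable.encode p) = (f p).map Encodable.encode := by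
      rw [hc]; simp
    constructor
    · intro h
      have : Encodable.encode s ∈ c.eval (Encodable.encode p) := by
        rw [key]; exact Part.mem_map _ h
      obtain ⟨t, ht⟩ := Nat.Partrec.Code.evaln_complete.1 this
      refine ⟨t, ?_⟩
      rw [Option.mem_def] at ht
      simp [ht]
    · rintro ⟨t, ht⟩
      simp only [Option.bind_eq_some_iff] at ht
      obtain ⟨a, h1, h2⟩ := ht
      have := Nat.Partrec.Code.evaln_complete.2 ⟨t, h1⟩
      rw [key, Part.mem_map_iff] at this
      obtain ⟨b, hb, rfl⟩ := this
      simp at h2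
      rwa [← h2]

/-- Machine found by search. -/
def srch (g : ℕ → List Bool → Option (List Bool)) : List Bool →. List Bool :=
  fun p => Nat.rfindOpt (fun k => g k p)

theorem srch_partrec {g : ℕ → List Bool → Option (List Bool)} (h : Computable₂ g) :
    Partrec (srch g) :=
  Partrec.rfindOpt (f := fun p k => g k p) (h.comp Computable.snd Computable.fst)

theorem srch_spec {g : ℕ → List Bool → Option (List Bool)} {p s} (h : s ∈ srch g p) :
    ∃ k, g k p = some s := by
  simpa using Nat.rfindOpt_spec h

theorem srch_ex {g : ℕ → List Bool → Option (List Bool)} {p s k} (h : g k p = some s) :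
    ∃ s', s' ∈ srch g p :=
  Part.dom_iff_mem.1 (Nat.rfindOpt_dom.2 ⟨k, s, h⟩)

theorem Hm_le {C : List Bool →. List Bool} {s p} (h : s ∈ C p) : Hm C s ≤ p.length :=
  sInf_le ⟨p, h, rfl⟩

theorem Hm_toNat_le {C : List Bool →. List Bool} {s p} (h : s ∈ C p) :
    (Hm C s).toNat ≤ p.length := by
  have := ENat.toNat_le_toNat (Hm_le h) (by simp)
  simpa using this

theorem Hm_attained {C : List Bool →. List Bool} {s p} (h : s ∈ C p) :
    ∃ q, s ∈ C q ∧ q.length = (Hm C s).toNat := by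
  have hne : ((fun p : List Bool => (p.length : ℕ∞)) '' {p | s ∈ C p}).Nonempty := ⟨_, p, h, rfl⟩
  obtain ⟨q, hq, hl⟩ := csInf_mem hne
  refine ⟨q, hq, ?_⟩
  unfold Hm
  rw [← hl]; simp

theorem fin_le (S : List Bool → Prop) (n : ℕ) :
    {p : List Bool | p.length ≤ n ∧ S p}.Finite :=
  (List.finite_length_le Bool n).subset fun _ h => h.1

/-- Lower bound, up to a shift. -/
theorem lower_shift (U V : List Bool →. List Bool) (hU : OptimalPFM U) (hV : OptimalPFM V) :
    ∃ d : ℕ, ∀ n : ℕ, ∀ q, strOfNat n ∈ U q → q.length ≤ n →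
      2 ^ (n - q.length) ≤ {p : List Bool | p.length ≤ n + d ∧ (V p).Dom}.ncard := by
  obtain ⟨u, hu, -, hmono, hspec⟩ := exists_step hU.1.1
  let g : ℕ → List Bool → Option (List Bool) := fun k p =>
    (u k.unpair.1 (p.take k.unpair.2)).bind
      (fun s => bif val1 s == p.length + 1 then some p else none)
  have hg : Computable₂ g := by
    apply Primrec₂.to_comp
    refine Primrec.option_bind (hu.comp (Primrec.fst.comp (Primrec.unpair.comp Primrec.fst))
      (Primrec.list_take.comp (Primrec.snd.comp (Primrec.unpair.comp Primrec.fst))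
        Primrec.snd)) ?_
    refine Primrec.cond (Primrec.beq.comp (primrec_val1.comp Primrec.snd)
      (Primrec.succ.comp (Primrec.list_length.comp (Primrec.snd.comp Primrec.fst))))
      (Primrec.option_some.comp (Primrec.snd.comp Primrec.fst)) (Primrec.const none)
  have hg1 : ∀ {k p s}, g k p = some s → s = p ∧
      ∃ i, strOfNat p.length ∈ U (p.take i) := by
    intro k p s h
    simp only [g, Option.bind_eq_some_iff] at h
    obtain ⟨a, h1, h2⟩ := h
    by_cases h3 : val1 a = p.length + 1
    · simp [h3] at h2
      have : a = strOfNat p.length := val1_inj (by rw [h3, val1_strOfNat])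
      exact ⟨h2.symm, _, (hspec _ _).2 ⟨_, this ▸ h1⟩⟩
    · have h4 : (val1 a == p.length + 1) = false := by simpa using h3
      simp [h4] at h2
  have hC : PFMachine (srch g) := by
    refine ⟨srch_partrec hg, ?_⟩
    intro p hp q hq hpq
    obtain ⟨s, hs⟩ := Part.dom_iff_mem.1 hp
    obtain ⟨s', hs'⟩ := Part.dom_iff_mem.1 hq
    obtain ⟨k, hk⟩ := srch_spec hs
    obtain ⟨k', hk'⟩ := srch_spec hs'
    obtain ⟨-, i, hi⟩ := hg1 hk
    obtain ⟨-, j, hj⟩ := hg1 hk'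
    have e : p.take i = q.take j := by
      have h1 : p.take i <+: q := (List.take_prefix _ _).trans hpq
      have h2 : q.take j <+: q := List.take_prefix _ _
      rcases List.prefix_or_prefix_of_prefix h1 h2 with h | h
      · exact hU.1.2 _ (Part.dom_iff_mem.2 ⟨_, hi⟩) _ (Part.dom_iff_mem.2 ⟨_, hj⟩) h
      · exact (hU.1.2 _ (Part.dom_iff_mem.2 ⟨_, hj⟩) _ (Part.dom_iff_mem.2 ⟨_, hi⟩) h).symm
    rw [e] at hi
    exact hpq.eq_of_length (strOfNat_inj (Part.mem_unique hi hj))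
  obtain ⟨d, hd⟩ := hV.2 _ hC
  refine ⟨d, fun n q hq hqn => ?_⟩
  have key : ∀ r : List.Vector Bool (n - q.length), ∃ x, (q ++ r.toList) ∈ V x ∧
      x.length ≤ n + d := by
    intro r
    obtain ⟨t, ht⟩ := (hspec _ _).1 hq
    have hl : (q ++ r.toList).length = n := by simp; omega
    have : g (Nat.pair t q.length) (q ++ r.toList) = some (q ++ r.toList) := by
      have h5 : q.length + (n - q.length) = n := by omega
      simp [g, ht, val1_strOfNat, h5]
    obtain ⟨s', hs'⟩ := srch_ex this
    obtain ⟨k', hk'⟩ := srch_spec hs'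
    obtain rfl := (hg1 hk').1
    obtain ⟨x, hx, hxl⟩ := hd _ _ hs'
    rw [hl] at hxl
    exact ⟨x, hx, hxl⟩
  choose F hF hFl using key
  have hinj : Function.Injective F := by
    intro r r' h
    have h1 := hF r
    rw [h] at h1
    have := Part.mem_unique h1 (hF r')
    exact Subtype.ext (List.append_cancel_left this)
  have : Nat.card (List.Vector Bool (n - q.length)) = 2 ^ (n - q.length) := by
    simp
  rw [← this, ← Set.ncard_univ, ← Set.ncard_image_of_injective _ hinj]
  refine Set.ncard_le_ncard ?_ (fin_le _ _)
  rintro _ ⟨r, -, rfl⟩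
  exact ⟨hFl r, Part.dom_iff_mem.2 ⟨_, hF r⟩⟩

/-- Subtracting a constant. -/
theorem sub_const (U : List Bool →. List Bool) (hU : OptimalPFM U) (d : ℕ) :
    ∃ e : ℕ, ∀ n q, strOfNat n ∈ U q → ∃ q', strOfNat (n - d) ∈ U q' ∧
      q'.length ≤ q.length + e := by
  let C : List Bool →. List Bool := fun q => (U q).map (fun s => strOfNat (val1 s - 1 - d))
  have hC : PFMachine C := by
    refine ⟨Partrec.map hU.1.1 (g := fun _ s => strOfNat (val1 s - 1 - d)) ?_, ?_⟩
    · refine computable_strOfNat.comp (Primrec.to_comp ?_)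
      exact Primrec.nat_sub.comp (Primrec.nat_sub.comp (primrec_val1.comp Primrec.snd)
        (Primrec.const 1)) (Primrec.const d)
    · intro p hp q hq h
      exact hU.1.2 p hp q hq h
  obtain ⟨e, he⟩ := hU.2 C hC
  refine ⟨e, fun n q hq => ?_⟩
  refine he q _ ?_
  refine (Part.mem_map_iff _).2 ⟨_, hq, ?_⟩
  simp [val1_strOfNat]

theorem primrec_two_pow : Primrec (fun n : ℕ => 2 ^ n) := by
  have h : Primrec (Nat.rec 1 (fun _ a => 2 * a) : ℕ → ℕ) :=
    Primrec.nat_rec₁ 1 (Primrec.nat_mul.comp (Primrec.const 2) Primrec.snd)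
  refine h.of_eq fun n => ?_
  induction n with
  | zero => rfl
  | succ n ih => simp only [ih]; ring

theorem foldl_val (s : List Bool) : ∀ c : ℕ,
    s.foldl (fun a b => 2 * a + b.toNat) c = c * 2 ^ s.length + val0 s := by
  induction s with
  | nil => simp [val0]
  | cons b s ih =>
    intro c
    have h0 : val0 (b :: s) = s.foldl (fun a b => 2 * a + b.toNat) (2 * 0 + b.toNat) := rfl
    rw [h0, List.foldl_cons, ih, ih]
    simp only [List.length_cons, pow_succ]; ring

theorem val0_append (s t : List Bool) : val0 (s ++ t) = val0 s * 2 ^ t.length + val0 t := by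
  rw [← foldl_val]; simp [val0]

theorem val0_lt (s : List Bool) : val0 s < 2 ^ s.length := by
  induction s using List.reverseRecOn with
  | nil => simp [val0]
  | append_singleton s b ih =>
    rw [val0_append]
    have : val0 [b] < 2 := by cases b <;> simp [val0]
    simp only [List.length_append, List.length_singleton, pow_succ, pow_zero, one_mul]
    omega

theorem val0_surj : ∀ L m : ℕ, m < 2 ^ L → ∃ p : List Bool, p.length = L ∧ val0 p = m := by
  intro L
  induction L with
  | zero => intro m hm; exact ⟨[], rfl, by simp at hm; simp [val0, hm]⟩
  | succ L ih =>
    intro m hm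
    rw [pow_succ] at hm
    obtain ⟨p, hp, hv⟩ := ih (m / 2) (by omega)
    refine ⟨p ++ [decide (m % 2 = 1)], by simp [hp], ?_⟩
    rw [val0_append, hv]
    by_cases h : m % 2 = 1
    · simp [h, val0]; omega
    · simp [h, val0]; omega

/-- Point of the unit interval coded by a string. -/
noncomputable def pt (p : List Bool) : ℝ := (val0 p : ℝ) / 2 ^ p.length

theorem pt_prefix {p q : List Bool} (h : p <+: q) :
    (val0 p : ℝ) / 2 ^ p.length ≤ pt q ∧ pt q < ((val0 p : ℝ) + 1) / 2 ^ p.length := by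
  obtain ⟨t, rfl⟩ := h
  have ht : (val0 t : ℝ) < 2 ^ t.length := by exact_mod_cast val0_lt t
  have h0 : (0 : ℝ) ≤ val0 t := by positivity
  unfold pt
  rw [val0_append, List.length_append, pow_add]
  have a1 : (0 : ℝ) < 2 ^ p.length := by positivity
  have a2 : (0 : ℝ) < 2 ^ t.length := by positivity
  push_cast
  constructor
  · rw [div_le_div_iff₀ a1 (by positivity)]
    nlinarith [mul_nonneg h0 a1.le]
  · rw [div_lt_div_iff₀ (by positivity) a1]
    nlinarith [mul_lt_mul_of_pos_right ht a1]

/-- Weight of a request. -/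
noncomputable def wt (o : Option (ℕ × List Bool)) : ℝ := o.elim 0 (fun x => 1 / 2 ^ x.1)

theorem wt_nonneg (o) : 0 ≤ wt o := by
  cases o <;> simp [wt]

/-- Update of the dyadic accumulator `N / 2 ^ L`. -/
def accStep (o : Option (ℕ × List Bool)) (x : ℕ × ℕ) : ℕ × ℕ :=
  (o.map (fun y => (x.1 * 2 ^ y.1 + 2 ^ x.2, x.2 + y.1))).getD x

theorem primrec_accStep : Primrec₂ accStep := by
  refine Primrec.option_getD.comp (Primrec.option_map Primrec.fst ?_) Primrec.snd
  refine Primrec.pair ?_ ?_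
  · refine Primrec.nat_add.comp (Primrec.nat_mul.comp
      (Primrec.fst.comp (Primrec.snd.comp Primrec.fst))
      (primrec_two_pow.comp (Primrec.fst.comp Primrec.snd)))
      (primrec_two_pow.comp (Primrec.snd.comp (Primrec.snd.comp Primrec.fst)))
  · exact Primrec.nat_add.comp (Primrec.snd.comp (Primrec.snd.comp Primrec.fst))
      (Primrec.fst.comp Primrec.snd)

/-- The accumulator. -/
def acc (r : ℕ → Option (ℕ × List Bool)) (k : ℕ) : ℕ × ℕ :=
  Nat.rec (0, 0) (fun i x => accStep (r i) x) k

theorem acc_spec (r : ℕ → Option (ℕ × List Bool)) (k : ℕ) :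
    ((acc r k).1 : ℝ) = (∑ i ∈ Finset.range k, wt (r i)) * 2 ^ (acc r k).2 := by
  induction k with
  | zero => simp [acc]
  | succ k ih =>
    have h : acc r (k + 1) = accStep (r k) (acc r k) := rfl
    rw [h, Finset.sum_range_succ]
    rcases hr : r k with _ | ⟨l, s⟩
    · simpa [accStep, wt] using ih
    · have hw : wt (some (l, s)) = 1 / 2 ^ l := rfl
      rw [hw]
      simp only [accStep, Option.map_some, Option.getD_some]
      push_cast
      rw [ih, pow_add]
      field_simp

/-- Kraft–Chaitin, with a loss of two bits. -/
theorem kraft_chaitin (r : ℕ → Option (ℕ × List Bool)) (hr : Computable r)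
    (hsum : ∀ k, ∑ i ∈ Finset.range k, wt (r i) ≤ 1) :
    ∃ C, PFMachine C ∧ ∀ k l s, r k = some (l, s) →
      ∃ p : List Bool, p.length = l + 2 ∧ s ∈ C p := by
  let S : ℕ → ℝ := fun k => ∑ i ∈ Finset.range k, wt (r i)
  have hSmono : Monotone S := by
    refine monotone_nat_of_le_succ fun k => ?_
    simp only [S, Finset.sum_range_succ]
    linarith [wt_nonneg (r k)]
  let m : ℕ → ℕ → ℕ := fun k l => (acc r k).1 * 2 ^ (l + 2) / 2 ^ (acc r k).2 + 1
  have hm : ∀ k l s, r k = some (l, s) →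
      S k ≤ (m k l : ℝ) / 2 ^ (l + 2) ∧ ((m k l : ℝ) + 1) / 2 ^ (l + 2) ≤ S (k + 1) := by
    intro k l s hk
    have e1 : ((acc r k).1 : ℝ) = S k * 2 ^ (acc r k).2 := acc_spec r k
    have e2 : S (k + 1) = S k + 1 / 2 ^ l := by
      simp only [S, Finset.sum_range_succ, hk, wt, Option.elim_some]
    have hp : 0 < 2 ^ (acc r k).2 := by positivity
    have h1 : (acc r k).1 * 2 ^ (l + 2) < m k l * 2 ^ (acc r k).2 := by
      rw [mul_comm (m k l)]
      exact Nat.lt_mul_div_succ _ hp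
    have h2 : (m k l - 1) * 2 ^ (acc r k).2 ≤ (acc r k).1 * 2 ^ (l + 2) := by
      simp only [m, Nat.add_sub_cancel]
      exact Nat.div_mul_le_self _ _
    have h3 : m k l * 2 ^ (acc r k).2 ≤ (acc r k).1 * 2 ^ (l + 2) + 2 ^ (acc r k).2 := by
      have : m k l = (m k l - 1) + 1 := by simp [m]
      rw [this, add_mul]; omega
    have h1' : ((acc r k).1 : ℝ) * 2 ^ (l + 2) < m k l * 2 ^ (acc r k).2 := by exact_mod_cast h1
    have h3' : (m k l : ℝ) * 2 ^ (acc r k).2 ≤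
      (acc r k).1 * 2 ^ (l + 2) + 2 ^ (acc r k).2 := by exact_mod_cast h3
    have hpr : (0 : ℝ) < 2 ^ (acc r k).2 := by positivity
    rw [e1] at h1' h3'
    have h1'' : S k * 2 ^ (l + 2) ≤ m k l := by
      refine le_of_mul_le_mul_right ?_ hpr
      nlinarith
    have h3'' : (m k l : ℝ) ≤ S k * 2 ^ (l + 2) + 1 := by
      refine le_of_mul_le_mul_right ?_ hpr
      nlinarith
    have hl : (0 : ℝ) < 2 ^ (l + 2) := by positivity
    refine ⟨(le_div_iff₀ hl).2 h1'', ?_⟩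
    rw [div_le_iff₀ hl, e2, add_mul]
    have : (1 : ℝ) / 2 ^ l * 2 ^ (l + 2) = 4 := by
      rw [pow_add]; field_simp; norm_num
    linarith
  let g : ℕ → List Bool → Option (List Bool) := fun k p =>
    (r k).bind (fun x => bif (p.length == x.1 + 2) && (val0 p == m k x.1) then some x.2 else none)
  have hacc : Computable (acc r) := by
    refine Computable.nat_rec Computable.id (Computable.const (0, 0))
      (h := fun (_ : ℕ) (x : ℕ × (ℕ × ℕ)) => accStep (r x.1) x.2) ?_
    exact primrec_accStep.to_comp.comp
      (hr.comp (Computable.fst.comp Computable.snd)) (Computable.snd.comp Computable.snd)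
  have hg : Computable₂ g := by
    refine Computable.option_bind (hr.comp Computable.fst) ?_
    have hl : Computable (fun a : (ℕ × List Bool) × (ℕ × List Bool) => a.2.1) :=
      Computable.fst.comp Computable.snd
    have hp : Computable (fun a : (ℕ × List Bool) × (ℕ × List Bool) => a.1.2) :=
      Computable.snd.comp Computable.fst
    have ha : Computable (fun a : (ℕ × List Bool) × (ℕ × List Bool) => acc r a.1.1) :=
      hacc.comp (Computable.fst.comp Computable.fst)
    have hl2 : Computable (fun a : (ℕ × List Bool) × (ℕ × List Bool) => a.2.1 + 2) :=
      Computable.succ.comp (Computable.succ.comp hl)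
    have hm : Computable (fun a : (ℕ × List Bool) × (ℕ × List Bool) => m a.1.1 a.2.1) := by
      refine Computable.succ.comp (Primrec.nat_div.to_comp.comp
        (Primrec.nat_mul.to_comp.comp (Computable.fst.comp ha)
          (primrec_two_pow.to_comp.comp hl2))
        (primrec_two_pow.to_comp.comp (Computable.snd.comp ha)))
    refine Computable.cond (Primrec.and.to_comp.comp
      (Primrec.beq.to_comp.comp (Computable.list_length.comp hp) hl2)
      (Primrec.beq.to_comp.comp (primrec_val0.to_comp.comp hp) hm))
      (Computable.option_some.comp (Computable.snd.comp Computable.snd)) (Computable.const none)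
  have hg1 : ∀ {k p s}, g k p = some s → ∃ l, r k = some (l, s) ∧ p.length = l + 2 ∧
      val0 p = m k l := by
    intro k p s h
    simp only [g, Option.bind_eq_some_iff] at h
    obtain ⟨⟨l, s'⟩, h1, h2⟩ := h
    cases hb : ((p.length == l + 2) && (val0 p == m k l)) with
    | false => simp [hb] at h2
    | true =>
      simp only [hb, cond_true, Option.some.injEq] at h2
      subst h2
      simp at hb
      exact ⟨l, h1, hb.1, hb.2⟩
  have huniq : ∀ {k k' p q s s'}, g k p = some s → g k' q = some s' → p <+: q → k = k' := by
    intro k k' p q s s' h h' hpq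
    obtain ⟨l, h1, h2, h3⟩ := hg1 h
    obtain ⟨l', h1', h2', h3'⟩ := hg1 h'
    have a := pt_prefix hpq
    have b := pt_prefix (List.prefix_refl q)
    have c := hm _ _ _ h1
    have c' := hm _ _ _ h1'
    rw [h2, h3] at a
    rw [h2', h3'] at b
    rcases lt_trichotomy k k' with hlt | heq | hlt
    · have := hSmono (Nat.succ_le_of_lt hlt)
      simp only [Nat.succ_eq_add_one] at this
      linarith
    · exact heq
    · have := hSmono (Nat.succ_le_of_lt hlt)
      simp only [Nat.succ_eq_add_one] at this
      linarith
  refine ⟨srch g, ⟨srch_partrec hg, ?_⟩, ?_⟩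
  · intro p hp q hq hpq
    obtain ⟨s, hs⟩ := Part.dom_iff_mem.1 hp
    obtain ⟨s', hs'⟩ := Part.dom_iff_mem.1 hq
    obtain ⟨k, hk⟩ := srch_spec hs
    obtain ⟨k', hk'⟩ := srch_spec hs'
    obtain rfl := huniq hk hk' hpq
    obtain ⟨l, h1, h2, h3⟩ := hg1 hk
    obtain ⟨l', h1', h2', h3'⟩ := hg1 hk'
    rw [h1] at h1'
    simp at h1'
    exact hpq.eq_of_length (by omega)
  · intro k l s hk
    have hlt : m k l < 2 ^ (l + 2) := by
      have := (hm k l s hk).2.trans (hsum (k + 1))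
      rw [div_le_one (by positivity)] at this
      have h2 : m k l + 1 ≤ 2 ^ (l + 2) := by exact_mod_cast this
      omega
    obtain ⟨p, hp, hv⟩ := val0_surj _ _ hlt
    have hgk : g k p = some s := by simp [g, hk, hp, hv]
    refine ⟨p, hp, ?_⟩
    obtain ⟨s', hs'⟩ := srch_ex hgk
    obtain ⟨k', hk'⟩ := srch_spec hs'
    obtain rfl := huniq hgk hk' (List.prefix_refl p)
    rw [hgk] at hk'
    simp at hk'
    rwa [hk']

theorem exists_enum {f : List Bool →. List Bool} (hf : Partrec f) :
    ∃ e : ℕ → Option (List Bool), Primrec e ∧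
      (∀ i i' p, e i = some p → e i' = some p → i = i') ∧
      (∀ p, (f p).Dom ↔ ∃ i, e i = some p) := by
  obtain ⟨u, hu, hu0, hmono, hspec⟩ := exists_step hf
  let e : ℕ → Option (List Bool) := fun i =>
    (Encodable.decode₂ (List Bool) i.unpair.1).bind (fun p =>
      bif (u (i.unpair.2 + 1) p).isSome && !(u i.unpair.2 p).isSome then some p else none)
  have he : Primrec e := by
    refine Primrec.option_bind (Primrec.decode₂.comp (Primrec.fst.comp Primrec.unpair)) ?_
    have h1 : Primrec (fun a : ℕ × List Bool => a.1.unpair.2) :=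
      Primrec.snd.comp (Primrec.unpair.comp Primrec.fst)
    refine Primrec.cond (Primrec.and.comp
      (Primrec.option_isSome.comp (hu.comp (Primrec.succ.comp h1) Primrec.snd))
      (Primrec.not.comp (Primrec.option_isSome.comp (hu.comp h1 Primrec.snd))))
      (Primrec.option_some.comp Primrec.snd) (Primrec.const none)
  have he1 : ∀ i p, e i = some p → i.unpair.1 = Encodable.encode p ∧
      (∃ s, u (i.unpair.2 + 1) p = some s) ∧ u i.unpair.2 p = none := by
    intro i p h
    simp only [e, Option.bind_eq_some_iff] at h
    obtain ⟨a, h1, h2⟩ := h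
    cases hb : ((u (i.unpair.2 + 1) a).isSome && !(u i.unpair.2 a).isSome) with
    | false => rw [hb] at h2; simp at h2
    | true =>
      simp only [hb, cond_true, Option.some.injEq] at h2
      subst h2
      simp only [Bool.and_eq_true, Bool.not_eq_true', Option.isSome_eq_false_iff,
        Option.isNone_iff_eq_none, Option.isSome_iff_exists] at hb
      refine ⟨?_, hb.1, hb.2⟩
      exact (Encodable.decode₂_eq_some.1 h1).symm
  refine ⟨e, he, ?_, ?_⟩
  · intro i i' p h h'
    obtain ⟨a1, ⟨s, a2⟩, a3⟩ := he1 i p h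
    obtain ⟨b1, ⟨s', b2⟩, b3⟩ := he1 i' p h'
    have : i.unpair.2 = i'.unpair.2 := by
      rcases lt_trichotomy i.unpair.2 i'.unpair.2 with hlt | heq | hlt
      · have := hmono _ _ _ _ (Nat.succ_le_of_lt hlt) a2
        simp [b3] at this
      · exact heq
      · have := hmono _ _ _ _ (Nat.succ_le_of_lt hlt) b2
        simp [a3] at this
    rw [← Nat.pair_unpair i, ← Nat.pair_unpair i', a1, b1, this]
  · intro p
    constructor
    · intro h
      obtain ⟨s, hs⟩ := Part.dom_iff_mem.1 h
      have hex : ∃ t, (u t p).isSome := by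
        obtain ⟨t, ht⟩ := (hspec p s).1 hs
        exact ⟨t, by simp [ht]⟩
      classical
      obtain ⟨t, ht⟩ : ∃ t, Nat.find hex = t + 1 := by
        refine Nat.exists_eq_succ_of_ne_zero fun h0 => ?_
        have := Nat.find_spec hex
        rw [h0, hu0] at this
        simp at this
      have h1 := Nat.find_spec hex
      rw [ht] at h1
      have h2 := Nat.find_min hex (m := t) (by omega)
      refine ⟨Nat.pair (Encodable.encode p) t, ?_⟩
      simp only [Bool.not_eq_true] at h2
      simp only [e, Nat.unpair_pair, Encodable.encodek₂, Option.bind_some, h1, h2]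
      rfl
    · rintro ⟨i, hi⟩
      obtain ⟨-, ⟨s, hs⟩, -⟩ := he1 i p hi
      exact Part.dom_iff_mem.2 ⟨s, (hspec p s).2 ⟨_, hs⟩⟩

theorem uniq_dec {S : Set (List Bool)} (h : PrefixFreeSet S) (h0 : [] ∉ S) :
    InformationTheory.UniquelyDecodable S := by
  intro L₁
  induction L₁ with
  | nil =>
    intro L₂ _ h2 he
    cases L₂ with
    | nil => rfl
    | cons w L =>
      simp only [List.flatten_nil, List.flatten_cons] at he
      have : w = [] := (List.append_eq_nil_iff.1 he.symm).1
      exact absurd (this ▸ h2 w (by simp)) h0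
  | cons v L ih =>
    intro L₂ h1 h2 he
    cases L₂ with
    | nil =>
      simp only [List.flatten_nil, List.flatten_cons] at he
      have : v = [] := (List.append_eq_nil_iff.1 he).1
      exact absurd (this ▸ h1 v (by simp)) h0
    | cons w L' =>
      simp only [List.flatten_cons] at he
      have hv : v <+: w ++ L'.flatten := ⟨_, he⟩
      have hw : w <+: w ++ L'.flatten := ⟨_, rfl⟩
      have e : v = w := by
        rcases List.prefix_or_prefix_of_prefix hv hw with h' | h'
        · exact h _ (h1 v (by simp)) _ (h2 w (by simp)) h'
        · exact (h _ (h2 w (by simp)) _ (h1 v (by simp)) h').symm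
      subst e
      rw [ih L' (fun x hx => h1 x (by simp [hx])) (fun x hx => h2 x (by simp [hx]))
        (List.append_cancel_left he)]

theorem kraft {S : Set (List Bool)} (h : PrefixFreeSet S) (D : Finset (List Bool))
    (hD : ∀ p ∈ D, p ∈ S) : ∑ p ∈ D, (1 : ℝ) / 2 ^ p.length ≤ 1 := by
  have hD' : PrefixFreeSet (D : Set (List Bool)) := fun p hp q hq =>
    h p (hD p hp) q (hD q hq)
  by_cases h0 : [] ∈ D
  · have : D = {[]} := by
      ext q
      simp only [Finset.mem_singleton]
      exact ⟨fun hq => (hD' [] h0 q hq List.nil_prefix).symm, fun hq => hq ▸ h0⟩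
    simp [this]
  · have := InformationTheory.kraft_mcmillan_inequality (uniq_dec hD' (by simpa using h0))
    simpa using this

theorem sum_two_pow (a K : ℕ) :
    (∑ j ∈ Finset.range K, if 2 ^ j ≤ a then 2 ^ j else 0) ≤ 2 * a ∧
    (∑ j ∈ Finset.range K, if 2 ^ j ≤ a then 2 ^ j else 0) + 1 ≤ 2 ^ K := by
  induction K with
  | zero => simp
  | succ K ih =>
    rw [Finset.sum_range_succ, pow_succ]
    split_ifs with h <;> omega

theorem sum_tail (l K : ℕ) :
    ∑ n ∈ Finset.range K, (if l ≤ n then (1 : ℝ) / 2 ^ (n + 1) else 0) ≤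
      if l ≤ K then 1 / 2 ^ l - 1 / 2 ^ K else 0 := by
  induction K with
  | zero =>
    split_ifs with h
    · have : l = 0 := by omega
      simp [this]
    · simp
  | succ K ih =>
    rw [Finset.sum_range_succ]
    by_cases h1 : l ≤ K
    · simp only [h1, if_true, show l ≤ K + 1 by omega] at ih ⊢
      have : (1 : ℝ) / 2 ^ K = 2 * (1 / 2 ^ (K + 1)) := by rw [pow_succ]; field_simp
      linarith
    · simp only [h1, if_false] at ih ⊢
      by_cases h2 : l ≤ K + 1
      · have : l = K + 1 := by omega
        simp only [this, le_refl, if_true, sub_self]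
        rw [← this]; linarith
      · simp only [h2, if_false]; linarith

theorem sum_card {S : List Bool → Prop} (h : PrefixFreeSet {p | S p}) (K : ℕ) :
    ∑ n ∈ Finset.range K, ({p : List Bool | p.length ≤ n ∧ S p}.ncard : ℝ) / 2 ^ (n + 1) ≤ 1 := by
  classical
  let D := (fin_le S K).toFinset
  have hD : ∀ n ∈ Finset.range K, ({p : List Bool | p.length ≤ n ∧ S p}.ncard : ℝ) / 2 ^ (n + 1) =
      ∑ p ∈ D, if p.length ≤ n then (1 : ℝ) / 2 ^ (n + 1) else 0 := by
    intro n hn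
    have hn' := Finset.mem_range.1 hn
    have e : {p : List Bool | p.length ≤ n ∧ S p} =
        ((D.filter fun p => p.length ≤ n : Finset (List Bool)) : Set (List Bool)) := by
      ext p
      simp only [D, Set.mem_ofPred_eq, Finset.coe_filter, Set.Finite.mem_toFinset]
      constructor
      · rintro ⟨h1, h2⟩; exact ⟨⟨by omega, h2⟩, h1⟩
      · rintro ⟨⟨_, h2⟩, h1⟩; exact ⟨h1, h2⟩
    rw [e, Set.ncard_coe_finset, ← Finset.sum_filter, Finset.sum_const, nsmul_eq_mul]
    ring
  rw [Finset.sum_congr rfl hD, Finset.sum_comm]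
  refine le_trans (Finset.sum_le_sum fun p hp => ?_) (kraft h D ?_)
  · refine (sum_tail p.length K).trans ?_
    have : (0 : ℝ) < 1 / 2 ^ K := by positivity
    have : (0 : ℝ) < 1 / 2 ^ p.length := by positivity
    split_ifs <;> linarith
  · intro p hp
    simp only [D, Set.Finite.mem_toFinset, Set.mem_ofPred_eq] at hp
    exact hp.2

theorem upper (U V : List Bool →. List Bool) (hU : OptimalPFM U) (hV : PFMachine V) :
    ∃ d : ℕ, ∀ n : ℕ, {p : List Bool | p.length ≤ n ∧ (V p).Dom}.ncard ≠ 0 →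
      ∃ q j, strOfNat n ∈ U q ∧ {p : List Bool | p.length ≤ n ∧ (V p).Dom}.ncard < 2 ^ (j + 1) ∧
        q.length + j ≤ n + 4 + d := by
  classical
  obtain ⟨e, he, heinj, hedom⟩ := exists_enum hV.1
  let a : ℕ → ℕ := fun n => {p : List Bool | p.length ≤ n ∧ (V p).Dom}.ncard
  have hasum : ∀ K, ∑ n ∈ Finset.range K, (a n : ℝ) / 2 ^ (n + 1) ≤ 1 := fun K =>
    sum_card (S := fun p => (V p).Dom) hV.2 K
  have hale : ∀ n, a n ≤ 2 ^ (n + 1) := by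
    intro n
    have h1 := hasum (n + 1)
    rw [Finset.sum_range_succ] at h1
    have h2 : (0 : ℝ) ≤ ∑ n ∈ Finset.range n, (a n : ℝ) / 2 ^ (n + 1) :=
      Finset.sum_nonneg fun i _ => by positivity
    have h3 : (a n : ℝ) / 2 ^ (n + 1) ≤ 1 := by linarith
    rw [div_le_one (by positivity)] at h3
    exact_mod_cast h3
  let c : ℕ → ℕ → Bool := fun n i => ((e i).map (fun p => decide (p.length ≤ n))).getD false
  have hc : ∀ n i, c n i = true ↔ ∃ p, e i = some p ∧ p.length ≤ n := by
    intro n i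
    rcases h : e i with _ | p <;> simp [c, h]
  have hcp : Primrec₂ c := by
    refine Primrec.option_getD.comp (Primrec.option_map (he.comp Primrec.snd) ?_)
      (Primrec.const false)
    exact Primrec.nat_le.decide.comp (Primrec.list_length.comp Primrec.snd)
      (Primrec.fst.comp Primrec.fst)
  have himg : ∀ n, (fun i => (e i).getD []) '' {i | c n i = true} =
      {p : List Bool | p.length ≤ n ∧ (V p).Dom} := by
    intro n
    ext p
    simp only [Set.mem_image, Set.mem_ofPred_eq, hc]
    constructor
    · rintro ⟨i, ⟨q, h1, h2⟩, rfl⟩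
      simp only [h1, Option.getD_some]
      exact ⟨h2, (hedom q).2 ⟨i, h1⟩⟩
    · rintro ⟨h1, h2⟩
      obtain ⟨i, hi⟩ := (hedom p).1 h2
      exact ⟨i, ⟨p, hi, h1⟩, by simp [hi]⟩
  have hinj : ∀ n, Set.InjOn (fun i => (e i).getD []) {i | c n i = true} := by
    intro n i hi i' hi' h
    obtain ⟨p, h1, -⟩ := (hc n i).1 hi
    obtain ⟨p', h1', -⟩ := (hc n i').1 hi'
    simp only [h1, h1', Option.getD_some] at h
    subst h
    exact heinj _ _ _ h1 h1'
  have hJfin : ∀ n, {i | c n i = true}.Finite := by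
    intro n
    refine Set.Finite.of_finite_image ?_ (hinj n)
    rw [himg]
    exact fin_le _ _
  have hJcard : ∀ n, {i | c n i = true}.ncard = a n := by
    intro n
    rw [← (hinj n).ncard_image, himg]
  let A : ℕ → ℕ → ℕ := fun n i => Nat.rec 0 (fun i' x => bif c n i' then x + 1 else x) i
  have hAs : ∀ n i, A n (i + 1) = bif c n i then A n i + 1 else A n i := fun _ _ => rfl
  have hAp : Primrec₂ A := by
    refine Primrec.nat_rec' (f := fun x : ℕ × ℕ => x.2) (g := fun _ => 0)
      (h := fun x y => bif c x.1 y.1 then y.2 + 1 else y.2) Primrec.snd (Primrec.const 0) ?_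
    exact Primrec.cond (hcp.comp (Primrec.fst.comp Primrec.fst) (Primrec.fst.comp Primrec.snd))
      (Primrec.succ.comp (Primrec.snd.comp Primrec.snd)) (Primrec.snd.comp Primrec.snd)
  have hAcard : ∀ n i, A n i = ((Finset.range i).filter (fun i => c n i = true)).card := by
    intro n i
    induction i with
    | zero => rfl
    | succ i ih =>
      rw [hAs, Finset.range_add_one, Finset.filter_insert, ih]
      cases h : c n i <;> simp
  have hA0 : ∀ n, A n 0 = 0 := fun _ => rfl
  clear_value A
  have hAle : ∀ n i, A n i ≤ a n := by
    intro n i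
    rw [hAcard, ← hJcard, ← Set.ncard_coe_finset]
    refine Set.ncard_le_ncard ?_ (hJfin n)
    intro x hx
    simpa using (Finset.mem_filter.1 hx).2
  have hAmono : ∀ n, Monotone (A n) := by
    intro n
    refine monotone_nat_of_le_succ fun i => ?_
    rw [hAs]
    cases c n i <;> simp
  have hAhit : ∀ n v, 1 ≤ v → v ≤ a n → ∃ i, c n i = true ∧ A n (i + 1) = v := by
    intro n v hv1 hv
    have hex : ∃ I, v ≤ A n I := by
      obtain ⟨B, hB⟩ := (hJfin n).bddAbove
      refine ⟨B + 1, hv.trans ?_⟩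
      rw [hAcard, ← hJcard, ← Set.ncard_coe_finset]
      refine Set.ncard_le_ncard ?_ (Finset.finite_toSet _)
      intro x hx
      have := hB hx
      simp only [Finset.coe_filter, Finset.mem_range, Set.mem_ofPred_eq]
      exact ⟨by omega, hx⟩
    obtain ⟨i, hi⟩ : ∃ i, Nat.find hex = i + 1 := by
      rcases hf : Nat.find hex with _ | i
      · have h5 := Nat.find_spec hex
        rw [hf, hA0] at h5
        omega
      · exact ⟨i, rfl⟩
    have h1 := Nat.find_spec hex
    have h2 := Nat.find_min hex (m := i) (by omega)
    rw [hi] at h1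
    refine ⟨i, ?_⟩
    have h3 := hAs n i
    cases h : c n i with
    | false => simp only [h, cond_false] at h3; omega
    | true => simp only [h, cond_true] at h3; exact ⟨rfl, by omega⟩
  let b : ℕ → ℕ → ℕ → Bool := fun n j i => c n i && (A n (i + 1) == 2 ^ j) && decide (j ≤ n + 2)
  let R : ℕ → ℕ → ℕ → Option (ℕ × List Bool) := fun n j i =>
    bif b n j i then some (n + 2 - j, strOfNat n) else none
  let r : ℕ → Option (ℕ × List Bool) := fun k => R k.unpair.1 k.unpair.2.unpair.1 k.unpair.2.unpair.2
  have hb : ∀ n j i, b n j i = true ↔ c n i = true ∧ A n (i + 1) = 2 ^ j ∧ j ≤ n + 2 := by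
    intro n j i
    simp [b, and_assoc]
  have hr : Computable r := by
    have hn : Primrec (fun k : ℕ => k.unpair.1) := Primrec.fst.comp Primrec.unpair
    have hj : Primrec (fun k : ℕ => k.unpair.2.unpair.1) :=
      Primrec.fst.comp (Primrec.unpair.comp (Primrec.snd.comp Primrec.unpair))
    have hi : Primrec (fun k : ℕ => k.unpair.2.unpair.2) :=
      Primrec.snd.comp (Primrec.unpair.comp (Primrec.snd.comp Primrec.unpair))
    have hn2 : Primrec (fun k : ℕ => k.unpair.1 + 2) := Primrec.succ.comp (Primrec.succ.comp hn)
    have hbp : Primrec (fun k : ℕ => b k.unpair.1 k.unpair.2.unpair.1 k.unpair.2.unpair.2) :=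
      Primrec.and.comp (Primrec.and.comp (hcp.comp hn hi)
        (Primrec.beq.comp (hAp.comp hn (Primrec.succ.comp hi)) (primrec_two_pow.comp hj)))
        (Primrec.nat_le.decide.comp hj hn2)
    refine Computable.cond hbp.to_comp (Computable.option_some.comp
      (Computable.pair (Primrec.nat_sub.comp hn2 hj).to_comp
        (computable_strOfNat.comp hn.to_comp))) (Computable.const none)
  have hwt : ∀ n j i, wt (R n j i) = if b n j i = true then (2 : ℝ) ^ j / 2 ^ (n + 2) else 0 := by
    intro n j i
    cases h : b n j i with
    | false => simp [R, h, wt]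
    | true =>
      have hj := ((hb n j i).1 h).2.2
      simp only [R, h, cond_true, wt, Option.elim_some, if_true]
      rw [div_eq_div_iff (by positivity) (by positivity), one_mul, ← pow_add]
      congr 1; omega
  have hsum : ∀ K, ∑ k ∈ Finset.range K, wt (r k) ≤ 1 := by
    intro K
    have s1 : ∑ k ∈ Finset.range K, wt (r k) ≤ ∑ n ∈ Finset.range K, ∑ j ∈ Finset.range K,
        ∑ i ∈ Finset.range K, wt (R n j i) := by
      have : ∑ n ∈ Finset.range K, ∑ j ∈ Finset.range K, ∑ i ∈ Finset.range K, wt (R n j i) =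
        ∑ x ∈ Finset.range K ×ˢ (Finset.range K ×ˢ Finset.range K), wt (R x.1 x.2.1 x.2.2) := by
        rw [Finset.sum_product]
        refine Finset.sum_congr rfl fun n _ => ?_
        rw [Finset.sum_product]
      rw [this]
      let φ : ℕ → ℕ × ℕ × ℕ := fun k => (k.unpair.1, k.unpair.2.unpair.1, k.unpair.2.unpair.2)
      have hφ : Function.Injective φ := by
        intro k k' h
        simp only [φ, Prod.mk.injEq] at h
        rw [← Nat.pair_unpair k, ← Nat.pair_unpair k', h.1, ← Nat.pair_unpair k.unpair.2,
          ← Nat.pair_unpair k'.unpair.2, h.2.1, h.2.2]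
      have e2 : ∑ k ∈ Finset.range K, wt (r k) =
          ∑ x ∈ (Finset.range K).image φ, wt (R x.1 x.2.1 x.2.2) := by
        rw [Finset.sum_image (fun _ _ _ _ h => hφ h)]
      rw [e2]
      refine Finset.sum_le_sum_of_subset_of_nonneg ?_ (fun _ _ _ => wt_nonneg _)
      intro x hx
      obtain ⟨k, hk, rfl⟩ := Finset.mem_image.1 hx
      have hk' := Finset.mem_range.1 hk
      have l1 := Nat.unpair_left_le k
      have l2 := Nat.unpair_right_le k
      have l3 := Nat.unpair_left_le k.unpair.2
      have l4 := Nat.unpair_right_le k.unpair.2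
      simp only [φ, Finset.mem_product, Finset.mem_range]
      omega
    refine s1.trans (le_trans (Finset.sum_le_sum fun n _ => ?_) (hasum K))
    have s2 : ∀ j, ∑ i ∈ Finset.range K, wt (R n j i) ≤
        ((if 2 ^ j ≤ a n then 2 ^ j else 0 : ℕ) : ℝ) / 2 ^ (n + 2) := by
      intro j
      simp only [hwt]
      rw [← Finset.sum_filter, Finset.sum_const, nsmul_eq_mul]
      have hcard : ((Finset.range K).filter (fun i => b n j i = true)).card ≤ 1 := by
        rw [Finset.card_le_one]
        have aux : ∀ i i', b n j i = true → b n j i' = true → ¬ i < i' := by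
          intro i i' h h' hlt
          obtain ⟨h1, h2, -⟩ := (hb _ _ _).1 h
          obtain ⟨h1', h2', -⟩ := (hb _ _ _).1 h'
          have := hAmono n (Nat.succ_le_of_lt hlt)
          simp only [Nat.succ_eq_add_one] at this
          have h3 := hAs n i'
          simp only [h1', cond_true] at h3
          omega
        intro i hi i' hi'
        have hi := (Finset.mem_filter.1 hi).2
        have hi' := (Finset.mem_filter.1 hi').2
        have q1 := aux i i' hi hi'
        have q2 := aux i' i hi' hi
        omega
      split_ifs with hj
      · have h1 : (((Finset.range K).filter (fun i => b n j i = true)).card : ℝ) ≤ 1 := by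
          exact_mod_cast hcard
        have h2 : (0 : ℝ) ≤ 2 ^ j / 2 ^ (n + 2) := by positivity
        push_cast
        nlinarith
      · have h0 : (Finset.range K).filter (fun i => b n j i = true) = ∅ := by
          rw [Finset.filter_eq_empty_iff]
          intro i _ h
          obtain ⟨h1, h2, -⟩ := (hb _ _ _).1 h
          exact hj (h2 ▸ hAle n (i + 1))
        simp [h0]
    refine (Finset.sum_le_sum fun j _ => s2 j).trans ?_
    rw [← Finset.sum_div, ← Nat.cast_sum]
    have s3 := (sum_two_pow (a n) K).1
    have s3' : ((∑ j ∈ Finset.range K, if 2 ^ j ≤ a n then 2 ^ j else 0 : ℕ) : ℝ) ≤ 2 * a n := by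
      exact_mod_cast s3
    rw [div_le_div_iff₀ (by positivity) (by positivity), pow_succ (2 : ℝ) (n + 1)]
    have : (0 : ℝ) < 2 ^ (n + 1) := by positivity
    nlinarith
  obtain ⟨C, hC, hCr⟩ := kraft_chaitin r hr hsum
  obtain ⟨d, hd⟩ := hU.2 C hC
  refine ⟨d, fun n hn => ?_⟩
  have hn' : a n ≠ 0 := hn
  let j := Nat.log 2 (a n)
  have hj1 : 2 ^ j ≤ a n := Nat.pow_log_le_self 2 hn'
  have hj2 : a n < 2 ^ (j + 1) := Nat.lt_pow_succ_log_self (by norm_num) _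
  have hj3 : j ≤ n + 1 := (Nat.pow_le_pow_iff_right (by norm_num)).1 (hj1.trans (hale n))
  obtain ⟨i, hi1, hi2⟩ := hAhit n (2 ^ j) Nat.one_le_two_pow hj1
  have hbt : b n j i = true := (hb n j i).2 ⟨hi1, hi2, by omega⟩
  have hrk : r (Nat.pair n (Nat.pair j i)) = some (n + 2 - j, strOfNat n) := by
    simp only [r, Nat.unpair_pair, R, hbt, cond_true]
  obtain ⟨p, hp, hps⟩ := hCr _ _ _ hrk
  obtain ⟨q, hq, hql⟩ := hd _ _ hps
  exact ⟨q, j, hq, hj2, by omega⟩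

/-- Solovay's theorem: for optimal `V` (and `H = H_U` for a fixed optimal `U`),
`#{p : |p| ≤ n, p ∈ dom V} = 2^(n − H(n) + O(1))`. -/
theorem card_dom_le_length (U V : List Bool →. List Bool)
    (hU : OptimalPFM U) (hV : OptimalPFM V) :
    ∃ d : ℕ,
      (∀ n : ℕ,
        ({p : List Bool | p.length ≤ n ∧ (V p).Dom}.ncard : ℝ) ≤
          2 ^ ((n : ℤ) - ((Hm U (strOfNat n)).toNat : ℤ) + d)) ∧
      (∀ n : ℕ, (Hm U (strOfNat n)).toNat + d ≤ n →
        (2 : ℝ) ^ ((n : ℤ) - ((Hm U (strOfNat n)).toNat : ℤ) - d) ≤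
          ({p : List Bool | p.length ≤ n ∧ (V p).Dom}.ncard : ℝ)) := by
  obtain ⟨d1, h1⟩ := upper U V hU hV.1
  obtain ⟨d2, h2⟩ := lower_shift U V hU hV
  obtain ⟨d3, h3⟩ := sub_const U hU d2
  obtain ⟨l, hl⟩ : ∃ l, ∃ x : List Bool, x.length = l ∧ (V x).Dom := by
    obtain ⟨d, hd⟩ := hV.2 (fun p => (bif p.length == 0 then some p else none : Option (List Bool))) (by
      have aux : ∀ p : List Bool,
          ((bif p.length == 0 then some p else none : Option (List Bool)) : Part (List Bool)).Dom →
          p = [] := by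
        intro p hp
        cases p with
        | nil => rfl
        | cons b p => simp at hp
      refine ⟨Computable.ofOption (Primrec.to_comp (Primrec.cond
        (Primrec.beq.comp Primrec.list_length (Primrec.const 0))
        Primrec.option_some (Primrec.const none))), ?_⟩
      intro p hp q hq _
      rw [aux p hp, aux q hq])
    obtain ⟨q, hq, -⟩ := hd [] [] (by simp)
    exact ⟨_, q, rfl, Part.dom_iff_mem.2 ⟨_, hq⟩⟩
  refine ⟨d1 + d2 + d3 + l + 5, fun n => ?_, fun n hn => ?_⟩
  · by_cases h0 : {p : List Bool | p.length ≤ n ∧ (V p).Dom}.ncard = 0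
    · rw [h0]; simp only [Nat.cast_zero]; positivity
    · obtain ⟨q, j, hq, hlt, hlen⟩ := h1 n h0
      have hH := Hm_toNat_le hq
      have e1 : ({p : List Bool | p.length ≤ n ∧ (V p).Dom}.ncard : ℝ) ≤ 2 ^ (j + 1) := by
        exact_mod_cast hlt.le
      refine e1.trans ?_
      rw [← zpow_natCast]
      refine zpow_le_zpow_right₀ (by norm_num) ?_
      push_cast
      omega
  · obtain ⟨x, hxl, hx⟩ := hl
    have h0 : {p : List Bool | p.length ≤ n ∧ (V p).Dom}.ncard ≠ 0 := by
      exact Set.ncard_ne_zero_of_mem (a := x) ⟨by omega, hx⟩ (fin_le _ _)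
    obtain ⟨q, -, hq, -⟩ := h1 n h0
    obtain ⟨q', hq', hl'⟩ := Hm_attained hq
    obtain ⟨y, hy, hyl⟩ := h3 n q' hq'
    have h4 := h2 (n - d2) y hy (by omega)
    rw [Nat.sub_add_cancel (by omega)] at h4
    have h5 : (2 : ℝ) ^ (n - d2 - y.length) ≤
        ({p : List Bool | p.length ≤ n ∧ (V p).Dom}.ncard : ℝ) := by exact_mod_cast h4
    refine le_trans ?_ h5
    rw [← zpow_natCast]
    refine zpow_le_zpow_right₀ (by norm_num) ?_
    push_cast
    omega
end

section
/- Let U be an optimal prefix-free machine, let b : {0,1}* × {0,1}* → {0,1}* be a fixed bijective total recursive pairing function (defining the joint complexity H(n,s) = H_U(b(n,s))), and let C be any prefix-free machine. Then there exists d ∈ ℕ such that #S_C(n,s) ≤ 2^{n − H(n,s) + d} for all n ∈ ℕ and all finite binary strings s, where S_C(n,s) = {p ∈ {0,1}* : |p| ≤ n and C(p) = s} and n is identified with a finite binary string via the bijection φ(s) = (the dyadic integer 1s) − 1. -/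
open scoped ENNReal

/-- numeric value of a binary string -/
def bval (q : List Bool) : ℕ := q.foldl (fun a c => 2 * a + c.toNat) 0

theorem bval_snoc (q : List Bool) (c : Bool) : bval (q ++ [c]) = 2 * bval q + c.toNat := by
  simp [bval]

theorem primrec_bval : Primrec bval := by
  refine Primrec.list_foldl (f := fun q : List Bool => q) (g := fun _ => 0)
    (h := fun _ (x : ℕ × Bool) => 2 * x.1 + x.2.toNat) Primrec.id (Primrec.const 0) ?_
  refine Primrec.nat_add.comp (Primrec.nat_mul.comp (Primrec.const 2)
    (Primrec.fst.comp Primrec.snd)) ?_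
  exact (Primrec.dom_finite Bool.toNat).comp (Primrec.snd.comp Primrec.snd)

theorem exists_bval (L : ℕ) : ∀ v < 2 ^ L, ∃ q : List Bool, q.length = L ∧ bval q = v := by
  induction L with
  | zero => intro v hv; exact ⟨[], rfl, by simp [bval]; omega⟩
  | succ L ih =>
    intro v hv
    obtain ⟨q, hq, hv'⟩ := ih (v / 2) (by rw [pow_succ] at hv; omega)
    refine ⟨q ++ [v % 2 == 1], by simp [hq], ?_⟩
    rw [bval_snoc, hv']
    rcases Nat.mod_two_eq_zero_or_one v with h | h <;> simp [h] <;> omega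

theorem bval_append (q r : List Bool) :
    bval q * 2 ^ r.length ≤ bval (q ++ r) ∧ bval (q ++ r) + 1 ≤ (bval q + 1) * 2 ^ r.length := by
  induction r using List.reverseRecOn with
  | nil => simp
  | append_singleton r c ih =>
    rw [← List.append_assoc, bval_snoc]
    simp only [List.length_append, List.length_singleton, pow_succ]
    have : c.toNat ≤ 1 := Bool.toNat_le c
    constructor <;> nlinarith [ih.1, ih.2]

set_option linter.unusedSectionVars false

section KC
variable {σ : Type*} [Primcodable σ]

def reqW (E : ℕ → Option (ℕ × σ)) (i : ℕ) : ℕ :=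
  ((E i).map fun x => 2 ^ (i + 2 - x.1)).getD 0

noncomputable def reqR (E : ℕ → Option (ℕ × σ)) (i : ℕ) : ℝ :=
  ((E i).map fun x => (1 / 2 : ℝ) ^ x.1).getD 0

def reqA (E : ℕ → Option (ℕ × σ)) (i : ℕ) : ℕ :=
  Nat.rec 0 (fun i a => 2 * (a + reqW E i)) i

def reqG (E : ℕ → Option (ℕ × σ)) (q : List Bool) (i : ℕ) : Option σ :=
  (E i).bind fun x =>
    if q.length = x.1 + 1 ∧ reqA E i * 2 ^ q.length ≤ bval q * 2 ^ (i + 2) ∧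
      (bval q + 1) * 2 ^ (i + 2) ≤ (reqA E i + reqW E i) * 2 ^ q.length
    then some x.2 else none

theorem primrec_reqW {E : ℕ → Option (ℕ × σ)} (hE : Primrec E) : Primrec (reqW E) := by
  refine Primrec.option_getD.comp (Primrec.option_map hE ?_) (Primrec.const 0)
  exact (primrec_two_pow.comp (Primrec.nat_sub.comp
    (Primrec.nat_add.comp Primrec.fst (Primrec.const 2)) (Primrec.fst.comp Primrec.snd))).to₂

theorem primrec_reqA {E : ℕ → Option (ℕ × σ)} (hE : Primrec E) : Primrec (reqA E) := by
  refine Primrec.nat_rec₁ (f := fun i a => 2 * (a + reqW E i)) 0 ?_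
  exact (Primrec.nat_mul.comp (Primrec.const 2)
    (Primrec.nat_add.comp Primrec.snd ((primrec_reqW hE).comp Primrec.fst))).to₂

theorem primrec_reqG {E : ℕ → Option (ℕ × σ)} (hE : Primrec E) : Primrec₂ (reqG E) := by
  refine Primrec.option_bind (f := fun p : List Bool × ℕ => E p.2) (g := fun p x =>
    if p.1.length = x.1 + 1 ∧ reqA E p.2 * 2 ^ p.1.length ≤ bval p.1 * 2 ^ (p.2 + 2) ∧
      (bval p.1 + 1) * 2 ^ (p.2 + 2) ≤ (reqA E p.2 + reqW E p.2) * 2 ^ p.1.length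
    then some x.2 else none) (hE.comp Primrec.snd) ?_
  have hq : Primrec (fun z : (List Bool × ℕ) × (ℕ × σ) => z.1.1) := Primrec.fst.comp Primrec.fst
  have hi : Primrec (fun z : (List Bool × ℕ) × (ℕ × σ) => z.1.2) := Primrec.snd.comp Primrec.fst
  have hl : Primrec (fun z : (List Bool × ℕ) × (ℕ × σ) => z.1.1.length) :=
    Primrec.list_length.comp hq
  have hA := (primrec_reqA hE).comp hi
  have hW := (primrec_reqW hE).comp hi
  have hv := primrec_bval.comp hq
  have hp := primrec_two_pow.comp hl
  have hp2 := primrec_two_pow.comp (Primrec.nat_add.comp hi (Primrec.const 2))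
  refine Primrec.ite ?_ (Primrec.option_some.comp (Primrec.snd.comp Primrec.snd))
    (Primrec.const none)
  refine PrimrecPred.and ?_ (PrimrecPred.and ?_ ?_)
  · exact Primrec.eq.comp hl (Primrec.succ.comp (Primrec.fst.comp Primrec.snd))
  · exact Primrec.nat_le.comp (Primrec.nat_mul.comp hA hp) (Primrec.nat_mul.comp hv hp2)
  · exact Primrec.nat_le.comp (Primrec.nat_mul.comp (Primrec.succ.comp hv) hp2)
      (Primrec.nat_mul.comp (Primrec.nat_add.comp hA hW) hp)

theorem reqW_cast {E : ℕ → Option (ℕ × σ)} (hl : ∀ i x, E i = some x → x.1 ≤ i + 2) (i : ℕ) :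
    (reqW E i : ℝ) = reqR E i * 2 ^ (i + 2) := by
  unfold reqW reqR
  rcases h : E i with _ | x
  · simp
  · have := hl i x h
    simp only [Option.map_some, Option.getD_some]
    push_cast
    rw [pow_sub₀ _ two_ne_zero this]
    simp [mul_comm]

theorem reqA_cast {E : ℕ → Option (ℕ × σ)} (hl : ∀ i x, E i = some x → x.1 ≤ i + 2) (i : ℕ) :
    (reqA E i : ℝ) = (∑ j ∈ Finset.range i, reqR E j) * 2 ^ (i + 2) := by
  induction i with
  | zero => simp [reqA]
  | succ i ih =>
    have : reqA E (i + 1) = 2 * (reqA E i + reqW E i) := rfl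
    rw [this]
    push_cast
    rw [ih, reqW_cast hl, Finset.sum_range_succ]
    ring

theorem reqR_nonneg (E : ℕ → Option (ℕ × σ)) (i : ℕ) : 0 ≤ reqR E i := by
  unfold reqR
  rcases E i with _ | x <;> simp

theorem reqG_spec {E : ℕ → Option (ℕ × σ)} (hl : ∀ i x, E i = some x → x.1 ≤ i + 2)
    (q : List Bool) (i : ℕ) (y : σ) :
    reqG E q i = some y ↔ E i = some (q.length - 1, y) ∧ 1 ≤ q.length ∧
      (∑ j ∈ Finset.range i, reqR E j) * 2 ^ q.length ≤ bval q ∧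
      (bval q : ℝ) + 1 ≤ (∑ j ∈ Finset.range (i + 1), reqR E j) * 2 ^ q.length := by
  have h1 : reqA E i * 2 ^ q.length ≤ bval q * 2 ^ (i + 2) ↔
      (∑ j ∈ Finset.range i, reqR E j) * 2 ^ q.length ≤ bval q := by
    rw [← Nat.cast_le (α := ℝ)]
    push_cast
    rw [reqA_cast hl, mul_right_comm, mul_le_mul_iff_left₀ (by positivity)]
  have h2 : (bval q + 1) * 2 ^ (i + 2) ≤ (reqA E i + reqW E i) * 2 ^ q.length ↔
      (bval q : ℝ) + 1 ≤ (∑ j ∈ Finset.range (i + 1), reqR E j) * 2 ^ q.length := by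
    rw [← Nat.cast_le (α := ℝ)]
    push_cast
    rw [reqA_cast hl, reqW_cast hl, ← add_mul, mul_right_comm,
      mul_le_mul_iff_left₀ (by positivity), Finset.sum_range_succ]
  unfold reqG
  rw [← h1, ← h2]
  rcases E i with _ | ⟨l, x⟩
  · simp
  · simp only [Option.bind_some, Option.some.injEq, Prod.mk.injEq, ite_eq_iff]
    constructor
    · rintro (⟨⟨h, h', h''⟩, rfl⟩ | h)
      · exact ⟨⟨by omega, rfl⟩, by omega, h', h''⟩
      · simp at h
    · rintro ⟨⟨rfl, rfl⟩, h, h', h''⟩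
      exact Or.inl ⟨⟨by omega, h', h''⟩, rfl⟩

theorem reqG_unique {E : ℕ → Option (ℕ × σ)} (hl : ∀ i x, E i = some x → x.1 ≤ i + 2)
    {q q' : List Bool} (hqq : q <+: q') {i i' : ℕ} {y y' : σ}
    (h : reqG E q i = some y) (h' : reqG E q' i' = some y') : i = i' := by
  obtain ⟨r, rfl⟩ := hqq
  rw [reqG_spec hl] at h h'
  obtain ⟨-, -, h1, h2⟩ := h
  obtain ⟨-, -, h3, h4⟩ := h'
  obtain ⟨h5, h6⟩ := bval_append q r
  have h5' : (bval q : ℝ) * 2 ^ r.length ≤ bval (q ++ r) := by exact_mod_cast h5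
  have h6' : (bval (q ++ r) : ℝ) + 1 ≤ (bval q + 1) * 2 ^ r.length := by exact_mod_cast h6
  have mono : ∀ a b : ℕ, a ≤ b → ∑ j ∈ Finset.range a, reqR E j ≤ ∑ j ∈ Finset.range b, reqR E j :=
    fun a b hab => Finset.sum_le_sum_of_subset_of_nonneg (Finset.range_mono hab)
      fun _ _ _ => reqR_nonneg E _
  rw [List.length_append, pow_add, ← mul_assoc] at h3 h4
  have hr : (0 : ℝ) < 2 ^ r.length := by positivity
  have hq : (0 : ℝ) < 2 ^ q.length := by positivity
  have e1 := mul_le_mul_of_nonneg_right h1 hr.le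
  have e2 := mul_le_mul_of_nonneg_right h2 hr.le
  rcases lt_trichotomy i i' with hlt | heq | hlt
  · have e3 := mul_le_mul_of_nonneg_right (mul_le_mul_of_nonneg_right (mono _ _ hlt) hq.le) hr.le
    linarith
  · exact heq
  · have e3 := mul_le_mul_of_nonneg_right (mul_le_mul_of_nonneg_right (mono _ _ hlt) hq.le) hr.le
    linarith

theorem kraft_chaitin_s15 {E : ℕ → Option (ℕ × σ)} (hE : Primrec E)
    (hl : ∀ i x, E i = some x → x.1 ≤ i + 2)
    (hs : ∀ N, ∑ j ∈ Finset.range N, reqR E j ≤ 1) :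
    ∃ D : List Bool →. σ, Partrec D ∧ (∀ p ∈ D.Dom, ∀ q ∈ D.Dom, p <+: q → p = q) ∧
      ∀ i l y, E i = some (l, y) → ∃ q : List Bool, q.length = l + 1 ∧ y ∈ D q := by
  refine ⟨fun q => Nat.rfindOpt (reqG E q), Partrec.rfindOpt (primrec_reqG hE).to_comp, ?_, ?_⟩
  · intro p hp q hq hpq
    obtain ⟨i, y, h⟩ := Nat.rfindOpt_dom.1 hp
    obtain ⟨i', y', h'⟩ := Nat.rfindOpt_dom.1 hq
    have := reqG_unique hl hpq h h'
    subst this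
    have h1 := ((reqG_spec hl _ _ _).1 h)
    have h2 := ((reqG_spec hl _ _ _).1 h')
    refine hpq.eq_of_length ?_
    have := h1.1.symm.trans h2.1
    simp only [Option.some.injEq, Prod.mk.injEq] at this
    have := h1.2.1; have := h2.2.1
    omega
  · intro i l y hi
    set a := ∑ j ∈ Finset.range i, reqR E j with ha
    have ha0 : 0 ≤ a := Finset.sum_nonneg fun _ _ => reqR_nonneg E _
    have hw : ∑ j ∈ Finset.range (i + 1), reqR E j = a + (1 / 2) ^ l := by
      rw [Finset.sum_range_succ, ← ha]; simp [reqR, hi]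
    have hw2 : (∑ j ∈ Finset.range (i + 1), reqR E j) * 2 ^ (l + 1) = a * 2 ^ (l + 1) + 2 := by
      rw [hw, add_mul, pow_succ, ← mul_assoc ((1 / 2 : ℝ) ^ l), ← mul_pow]; norm_num
    have hc1 := Nat.le_ceil (a * 2 ^ (l + 1))
    have hc2 := Nat.ceil_lt_add_one (a := a * 2 ^ (l + 1)) (by positivity)
    obtain ⟨q, hq, hv⟩ := exists_bval (l + 1) ⌈a * 2 ^ (l + 1)⌉₊ (by
      rw [← Nat.cast_lt (α := ℝ)]
      have := mul_le_mul_of_nonneg_right (hs (i + 1)) (show (0 : ℝ) ≤ 2 ^ (l + 1) by positivity)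
      push_cast
      linarith)
    refine ⟨q, hq, ?_⟩
    have hG : reqG E q i = some y := by
      rw [reqG_spec hl, hq, hv, hw2]
      exact ⟨by simpa using hi, by omega, hc1, by linarith⟩
    obtain ⟨z, hz⟩ := Part.dom_iff_mem.1 (Nat.rfindOpt_dom.2 ⟨i, y, hG⟩)
    obtain ⟨i', hz'⟩ := Nat.rfindOpt_spec hz
    have := reqG_unique hl (List.prefix_refl q) hG hz'
    subst this
    have : reqG E q i = some z := hz'
    rw [hG] at this
    cases this
    exact hz
end KC

def strStep (z : ℕ × List Bool) : ℕ × List Bool :=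
  if z.1 ≤ 1 then z else (z.1 / 2, (z.1 % 2 == 1) :: z.2)

theorem primrec_strStep : Primrec strStep := by
  refine Primrec.ite (Primrec.nat_le.comp Primrec.fst (Primrec.const 1)) Primrec.id ?_
  refine Primrec.pair (Primrec.nat_div.comp Primrec.fst (Primrec.const 2)) ?_
  exact Primrec.list_cons.comp (Primrec.beq.comp (Primrec.nat_mod.comp Primrec.fst
    (Primrec.const 2)) (Primrec.const 1)) Primrec.snd

theorem bits_step (m : ℕ) (hm : 1 < m) : m.bits = (m % 2 == 1) :: (m / 2).bits := by
  rcases Nat.mod_two_eq_zero_or_one m with h | h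
  · have : m = 2 * (m / 2) := by omega
    conv_lhs => rw [this, Nat.bit0_bits _ (by omega)]
    simp [h]
  · have : m = 2 * (m / 2) + 1 := by omega
    conv_lhs => rw [this, Nat.bit1_bits]
    simp [h]

theorem strStep_iterate (f : ℕ) : ∀ m acc, 1 ≤ m → m ≤ f + 1 →
    (strStep^[f] (m, acc)).2 = m.bits.dropLast.reverse ++ acc := by
  induction f with
  | zero =>
    intro m acc h1 h2
    obtain rfl : m = 1 := by omega
    simp
  | succ f ih =>
    intro m acc h1 h2
    rw [Function.iterate_succ_apply]
    by_cases hm : m ≤ 1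
    · rw [show strStep (m, acc) = (m, acc) by simp [strStep, hm]]
      exact ih m acc h1 (by omega)
    · rw [show strStep (m, acc) = (m / 2, (m % 2 == 1) :: acc) by simp [strStep, hm]]
      rw [ih _ _ (by omega) (by omega), bits_step m (by omega)]
      have hne : (m / 2).bits ≠ [] := by
        intro h
        have := Nat.size_eq_bits_len (m / 2)
        rw [h, List.length_nil] at this
        have := Nat.size_eq_zero.1 this.symm
        omega
      rw [List.dropLast_cons_of_ne_nil hne]
      simp

theorem primrec_strOfNat : Primrec strOfNat := by
  refine (Primrec.snd.comp (Primrec.nat_iterate (f := fun n : ℕ => n)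
    (g := fun n : ℕ => (n + 1, ([] : List Bool))) (h := fun _ z => strStep z) Primrec.id
    (Primrec.pair Primrec.succ (Primrec.const [])) (primrec_strStep.comp Primrec.snd).to₂)).of_eq
    fun n => ?_
  have := strStep_iterate n (n + 1) [] (by omega) le_rfl
  simpa [strOfNat] using this

theorem kraft_prefixFree (T : Finset (List Bool)) (hT : PrefixFreeSet (T : Set (List Bool))) :
    ∑ p ∈ T, (1 / 2 : ℝ) ^ p.length ≤ 1 := by
  by_cases hnil : [] ∈ T
  · have : T = {[]} := by
      ext p
      simp only [Finset.mem_singleton]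
      exact ⟨fun hp => (hT [] hnil p hp List.nil_prefix).symm, fun h => h ▸ hnil⟩
    simp [this]
  · have hU : InformationTheory.UniquelyDecodable (T : Set (List Bool)) := by
      intro L₁
      induction L₁ with
      | nil =>
        intro L₂ _ h2 h
        rcases L₂ with _ | ⟨a, L₂⟩
        · rfl
        · simp at h
          have := h2 a (by simp)
          rw [h.1] at this
          exact absurd this hnil
      | cons a L₁ ih =>
        intro L₂ h1 h2 h
        rcases L₂ with _ | ⟨c, L₂⟩
        · simp at h
          have := h1 a (by simp)
          rw [h.1] at this
          exact absurd this hnil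
        · have ha := h1 a (by simp)
          have hc := h2 c (by simp)
          simp only [List.flatten_cons] at h
          have hac : a = c := by
            rcases List.prefix_or_prefix_of_prefix (l₁ := a) (l₂ := c) (l₃ := a ++ L₁.flatten)
              (List.prefix_append a _) (h ▸ List.prefix_append c L₂.flatten) with h' | h'
            · exact hT a ha c hc h'
            · exact (hT c hc a ha h').symm
          subst hac
          rw [ih L₂ (fun w hw => h1 w (by simp [hw])) (fun w hw => h2 w (by simp [hw]))
            (List.append_cancel_left h)]
    have := InformationTheory.kraft_mcmillan_inequality hU
    simpa using this

theorem exists_stage (C : List Bool →. List Bool) (hC : Partrec C) :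
    ∃ st : ℕ → List Bool → Option (List Bool), Primrec₂ st ∧ (∀ p, st 0 p = none) ∧
      (∀ k k' p s, k ≤ k' → st k p = some s → st k' p = some s) ∧
      ∀ p s, s ∈ C p ↔ ∃ k, st k p = some s := by
  obtain ⟨c, hc⟩ := Nat.Partrec.Code.exists_code.1 hC
  refine ⟨fun k p => (Nat.Partrec.Code.evaln k c (Encodable.encode p)).bind
    fun m => Encodable.decode m, ?_, ?_, ?_, ?_⟩
  · refine Primrec.option_bind ?_ (Primrec.decode.comp Primrec.snd).to₂
    exact Nat.Partrec.Code.primrec_evaln.comp (Primrec.pair (Primrec.pair Primrec.fst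
      (Primrec.const c)) (Primrec.encode.comp Primrec.snd))
  · intro p
    simp [Nat.Partrec.Code.evaln]
  · intro k k' p s hk h
    obtain ⟨m, hm, hs⟩ := Option.bind_eq_some_iff.1 h
    exact Option.bind_eq_some_iff.2 ⟨m, Nat.Partrec.Code.evaln_mono hk hm, hs⟩
  · intro p s
    have key : ∀ m, m ∈ c.eval (Encodable.encode p) ↔ ∃ s, s ∈ C p ∧ Encodable.encode s = m := by
      intro m
      rw [hc]
      simp
    constructor
    · intro hs
      obtain ⟨k, hk⟩ := Nat.Partrec.Code.evaln_complete.1 ((key _).2 ⟨s, hs, rfl⟩)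
      exact ⟨k, Option.bind_eq_some_iff.2 ⟨_, hk, Encodable.encodek s⟩⟩
    · rintro ⟨k, hk⟩
      obtain ⟨m, hm, hs⟩ := Option.bind_eq_some_iff.1 hk
      obtain ⟨s', hs', rfl⟩ := (key m).1 (Nat.Partrec.Code.evaln_sound hm)
      rw [Encodable.encodek] at hs
      cases hs
      exact hs'

theorem exists_events (C : List Bool →. List Bool) (hC : Partrec C) :
    ∃ (F : ℕ → Option (ℕ × List Bool)) (P : ℕ → List Bool), Primrec F ∧
      (∀ i n s, F i = some (n, s) → n ≤ i ∧ s ∈ C (P i) ∧ (P i).length ≤ n) ∧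
      (∀ i i' n s s', F i = some (n, s) → F i' = some (n, s') → P i = P i' → i = i') ∧
      ∀ p n s, s ∈ C p → p.length ≤ n → ∃ i, F i = some (n, s) ∧ P i = p := by
  obtain ⟨st, hst, h0, hmono, hiff⟩ := exists_stage C hC
  let P : ℕ → List Bool := fun i => (Encodable.decode i.unpair.2.unpair.1).getD []
  let Q : ℕ → ℕ := fun i => i.unpair.2.unpair.1
  have hQ : Primrec Q := Primrec.fst.comp (Primrec.unpair.comp (Primrec.snd.comp Primrec.unpair))
  have hP : Primrec P := Primrec.option_getD.comp (Primrec.decode.comp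
    hQ) (Primrec.const [])
  let M : ℕ → ℕ := fun i => i.unpair.2.unpair.2
  have hM : Primrec M := Primrec.snd.comp (Primrec.unpair.comp (Primrec.snd.comp Primrec.unpair))
  let K : ℕ → ℕ := fun i => i.unpair.1
  have hK : Primrec K := Primrec.fst.comp Primrec.unpair
  let F : ℕ → Option (ℕ × List Bool) := fun i =>
    if ((P i).length ≤ M i ∧ Encodable.encode (P i) = Q i) ∧ st (K i) (P i) = none then
      (st (K i + 1) (P i)).map fun s => (M i, s) else none
  have hF : ∀ i n s, F i = some (n, s) ↔
      ((P i).length ≤ M i ∧ Encodable.encode (P i) = Q i) ∧ st (K i) (P i) = none ∧ st (K i + 1) (P i) = some s ∧ M i = n := by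
    intro i n s
    simp only [F]
    split_ifs with h
    · simp [h]
    · simp only [reduceCtorEq, false_iff]
      tauto
  refine ⟨F, P, ?_, ?_, ?_, ?_⟩
  · refine Primrec.ite (PrimrecPred.and (PrimrecPred.and (Primrec.nat_le.comp
      (Primrec.list_length.comp hP) hM) (Primrec.eq.comp (Primrec.encode.comp hP) hQ))
      (Primrec.eq.comp (hst.comp hK hP) (Primrec.const none))) ?_ (Primrec.const none)
    exact Primrec.option_map (hst.comp (Primrec.succ.comp hK) hP)
      (Primrec.pair (hM.comp Primrec.fst) Primrec.snd).to₂
  · intro i n s h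
    obtain ⟨h1, -, h3, rfl⟩ := (hF i n s).1 h
    exact ⟨(Nat.unpair_right_le _).trans (Nat.unpair_right_le _), (hiff _ _).2 ⟨_, h3⟩, h1.1⟩
  · intro i i' n s s' h h' hp
    obtain ⟨⟨-, hq⟩, h2, h3, h4⟩ := (hF i n s).1 h
    obtain ⟨⟨-, hq'⟩, h2', h3', h4'⟩ := (hF i' n s').1 h'
    rw [← hp] at h2' h3'
    have hk : K i = K i' := by
      rcases lt_trichotomy (K i) (K i') with hlt | heq | hlt
      · rw [hmono _ _ _ _ hlt h3] at h2'; cases h2'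
      · exact heq
      · rw [hmono _ _ _ _ hlt h3'] at h2; cases h2
    have hp' : i.unpair.2.unpair.1 = i'.unpair.2.unpair.1 := by
      rw [hp] at hq
      exact hq.symm.trans hq'
    have h2 : i.unpair.2 = i'.unpair.2 := by
      rw [← Nat.pair_unpair i.unpair.2, ← Nat.pair_unpair i'.unpair.2, hp']
      exact congrArg _ (h4.trans h4'.symm)
    rw [← Nat.pair_unpair i, ← Nat.pair_unpair i', h2]
    exact congrArg (fun a => Nat.pair a _) hk
  · intro p n s hs hl
    classical
    have hex := (hiff p s).1 hs
    have hsp := Nat.find_spec hex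
    obtain ⟨k, hk⟩ : ∃ k, Nat.find hex = k + 1 := by
      refine Nat.exists_eq_succ_of_ne_zero fun h => ?_
      rw [h, h0] at hsp
      cases hsp
    have hn : st k p = none := by
      rcases h : st k p with _ | s'
      · rfl
      · exfalso
        have := hmono _ _ _ _ (Nat.le_succ k) h
        rw [hk] at hsp
        have e := this.symm.trans hsp
        rw [← h] at *
        exact Nat.find_min hex (by omega : k < Nat.find hex) (by rw [h]; exact e)
    rw [hk] at hsp
    refine ⟨Nat.pair k (Nat.pair (Encodable.encode p) n), ?_, ?_⟩
    · rw [hF]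
      simpa [P, M, K, Q] using ⟨hl, hn, hsp⟩
    · simp [P]

theorem sum_tail_le (l N : ℕ) :
    ∑ n ∈ Finset.range N, (if l ≤ n then (1 / 2 : ℝ) ^ (n + 1) else 0) ≤ (1 / 2) ^ l := by
  have : ∑ n ∈ Finset.range N, (if l ≤ n then (1 / 2 : ℝ) ^ (n + 1) else 0)
      = (1 / 2) ^ l - (1 / 2) ^ (max l N) := by
    induction N with
    | zero => simp
    | succ N ih =>
      rw [Finset.sum_range_succ, ih]
      split_ifs with h
      · rw [max_eq_right h, max_eq_right (by omega), pow_succ]; ring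
      · rw [max_eq_left (by omega), max_eq_left (by omega)]; ring
  rw [this]
  have : (0 : ℝ) ≤ (1 / 2) ^ (max l N) := by positivity
  linarith

noncomputable def evR (F : ℕ → Option (ℕ × List Bool)) (i : ℕ) : ℝ :=
  ((F i).map fun x => (1 / 2 : ℝ) ^ (x.1 + 1)).getD 0

theorem sum_evR_le {C : List Bool →. List Bool} (hpf : PrefixFreeSet C.Dom)
    {F : ℕ → Option (ℕ × List Bool)} {P : ℕ → List Bool}
    (h1 : ∀ i n s, F i = some (n, s) → n ≤ i ∧ s ∈ C (P i) ∧ (P i).length ≤ n)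
    (h2 : ∀ i i' n s s', F i = some (n, s) → F i' = some (n, s') → P i = P i' → i = i')
    (N : ℕ) : ∑ i ∈ Finset.range N, evR F i ≤ 1 := by
  classical
  set S := (Finset.range N).filter (fun i => (F i).isSome) with hS
  let m : ℕ → ℕ := fun i => ((F i).getD (0, [])).1
  let g : List Bool × ℕ → ℝ := fun z => if z.1.length ≤ z.2 then (1 / 2 : ℝ) ^ (z.2 + 1) else 0
  have hSF : ∀ i ∈ S, i < N ∧ ∃ s, F i = some (m i, s) := by
    intro i hi
    rw [hS, Finset.mem_filter, Finset.mem_range] at hi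
    obtain ⟨x, hx⟩ := Option.isSome_iff_exists.1 hi.2
    exact ⟨hi.1, x.2, by simp [m, hx]⟩
  have e1 : ∑ i ∈ Finset.range N, evR F i = ∑ i ∈ S, g (P i, m i) := by
    rw [hS, Finset.sum_filter]
    refine Finset.sum_congr rfl fun i _ => ?_
    rcases h : F i with _ | ⟨n, s⟩
    · simp [evR, h]
    · have := (h1 i n s h).2.2
      simp [evR, h, g, m, this]
  have hinj : Set.InjOn (fun i => (P i, m i)) (S : Set ℕ) := by
    intro i hi j hj hij
    obtain ⟨-, s, hs⟩ := hSF i hi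
    obtain ⟨-, s', hs'⟩ := hSF j hj
    simp only [Prod.mk.injEq] at hij
    rw [← hij.2] at hs'
    exact h2 i j _ _ _ hs hs' hij.1
  have hg : ∀ z, 0 ≤ g z := by
    intro z; simp only [g]; split_ifs <;> positivity
  rw [e1, ← Finset.sum_image (f := g) hinj]
  calc _ ≤ ∑ z ∈ (S.image P) ×ˢ Finset.range N, g z := by
        refine Finset.sum_le_sum_of_subset_of_nonneg ?_ fun z _ _ => hg z
        intro z hz
        obtain ⟨i, hi, rfl⟩ := Finset.mem_image.1 hz
        obtain ⟨hN, s, hs⟩ := hSF i hi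
        have := (h1 i _ _ hs).1
        exact Finset.mem_product.2 ⟨Finset.mem_image_of_mem P hi,
          Finset.mem_range.2 (by simp only; omega)⟩
    _ = ∑ p ∈ S.image P, ∑ n ∈ Finset.range N, g (p, n) := Finset.sum_product _ _ _
    _ ≤ ∑ p ∈ S.image P, (1 / 2 : ℝ) ^ p.length :=
        Finset.sum_le_sum fun p _ => sum_tail_le p.length N
    _ ≤ 1 := by
        refine kraft_prefixFree _ ?_
        have hd : ∀ p ∈ (S.image P : Finset _), p ∈ C.Dom := by
          intro p hp
          obtain ⟨i, hi, rfl⟩ := Finset.mem_image.1 hp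
          obtain ⟨-, s, hs⟩ := hSF i hi
          exact Part.dom_iff_mem.2 ⟨s, (h1 i _ _ hs).2.1⟩
        intro p hp q hq hpq
        exact hpf p (hd p hp) q (hd q hq) hpq

def cnt (F : ℕ → Option (ℕ × List Bool)) (x : ℕ × List Bool) (N : ℕ) : ℕ :=
  Nat.rec 0 (fun i c => if F i = some x then c + 1 else c) N

theorem cnt_succ (F : ℕ → Option (ℕ × List Bool)) (x : ℕ × List Bool) (N : ℕ) :
    cnt F x (N + 1) = if F N = some x then cnt F x N + 1 else cnt F x N := rfl

theorem primrec_cnt {F : ℕ → Option (ℕ × List Bool)} (hF : Primrec F) : Primrec₂ (cnt F) := by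
  refine Primrec.nat_rec (f := fun _ : ℕ × List Bool => 0)
    (g := fun x z => if F z.1 = some x then z.2 + 1 else z.2) (Primrec.const 0) ?_
  refine Primrec.ite (Primrec.eq.comp (hF.comp (Primrec.fst.comp Primrec.snd))
    (Primrec.option_some.comp Primrec.fst)) (Primrec.succ.comp (Primrec.snd.comp Primrec.snd))
    (Primrec.snd.comp Primrec.snd)

theorem cnt_eq_card (F : ℕ → Option (ℕ × List Bool)) (x : ℕ × List Bool) (N : ℕ) :
    cnt F x N = ((Finset.range N).filter (fun i => F i = some x)).card := by
  induction N with
  | zero => simp [cnt]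
  | succ N ih =>
    rw [cnt_succ, Finset.range_add_one, Finset.filter_insert]
    split_ifs with h
    · rw [Finset.card_insert_of_notMem (by simp), ih]
    · exact ih

theorem primrec_log2 : Primrec (fun c : ℕ => Nat.log 2 c) := by
  refine (Primrec.nat_findGreatest (f := fun c : ℕ => c) (p := fun c k => 2 ^ k ≤ c) Primrec.id
    (Primrec.nat_le.comp (primrec_two_pow.comp Primrec.snd) Primrec.fst)).of_eq fun c => ?_
  rcases Nat.eq_zero_or_pos c with rfl | hc
  · simp
  · rw [Nat.findGreatest_eq_iff]
    refine ⟨Nat.log_le_self 2 c, fun _ => Nat.pow_log_le_self 2 hc.ne', fun n hn _ h => ?_⟩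
    have := Nat.le_log_of_pow_le (by norm_num) h
    omega

def req (F : ℕ → Option (ℕ × List Bool)) (i : ℕ) : Option (ℕ × (ℕ × List Bool)) :=
  (F i).bind fun x =>
    if 2 ^ Nat.log 2 (cnt F x (i + 1)) = cnt F x (i + 1) then
      some (x.1 + 2 - Nat.log 2 (cnt F x (i + 1)), x) else none

theorem primrec_req {F : ℕ → Option (ℕ × List Bool)} (hF : Primrec F) : Primrec (req F) := by
  refine Primrec.option_bind hF ?_
  have hc : Primrec (fun z : ℕ × (ℕ × List Bool) => cnt F z.2 (z.1 + 1)) :=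
    (primrec_cnt hF).comp Primrec.snd (Primrec.succ.comp Primrec.fst)
  have hk := primrec_log2.comp hc
  refine Primrec.ite (Primrec.eq.comp (primrec_two_pow.comp hk) hc) ?_ (Primrec.const none)
  exact Primrec.option_some.comp (Primrec.pair (Primrec.nat_sub.comp
    (Primrec.nat_add.comp (Primrec.fst.comp Primrec.snd) (Primrec.const 2)) hk) Primrec.snd)

/-- total of the powers of two up to `c` -/
def powSum (c : ℕ) : ℕ :=
  ∑ j ∈ Finset.range c, if 2 ^ Nat.log 2 (j + 1) = j + 1 then j + 1 else 0

theorem powSum_le (c : ℕ) : powSum c ≤ 2 * c := by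
  rcases Nat.eq_zero_or_pos c with rfl | hc
  · simp [powSum]
  have key : powSum c + 1 ≤ 2 ^ (Nat.log 2 c + 1) := by
    induction c, hc using Nat.le_induction with
    | base => simp [powSum]
    | succ c hc ih =>
      unfold powSum at ih ⊢
      rw [Finset.sum_range_succ]
      split_ifs with h
      · set k := Nat.log 2 (c + 1)
        have hk : k ≠ 0 := by
          intro hk
          rw [hk] at h
          simp at h
          omega
        have : Nat.log 2 c + 1 ≤ k := Nat.log_lt_of_lt_pow (by omega) (by omega)
        have := Nat.pow_le_pow_right (n := 2) (by norm_num) this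
        rw [pow_succ 2 k]
        omega
      · have := Nat.pow_le_pow_right (n := 2) (by norm_num)
          (Nat.add_le_add_right (Nat.log_mono_right (b := 2) (show c ≤ c + 1 by omega)) 1)
        omega
  have := Nat.pow_log_le_self 2 (x := c) (by omega)
  rw [pow_succ] at key
  omega

theorem cnt_mul_eq (F : ℕ → Option (ℕ × List Bool)) (x : ℕ × List Bool) (N : ℕ) :
    ∑ i ∈ Finset.range N, (if F i = some x then evR F i else 0) =
      cnt F x N * (1 / 2 : ℝ) ^ (x.1 + 1) := by
  induction N with
  | zero => simp [cnt]
  | succ N ih =>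
    rw [Finset.sum_range_succ, ih, cnt_succ]
    split_ifs with h
    · simp only [evR, h, Option.map_some, Option.getD_some]
      push_cast; ring
    · simp

theorem evR_nonneg (F : ℕ → Option (ℕ × List Bool)) (i : ℕ) : 0 ≤ evR F i := by
  unfold evR
  rcases F i with _ | x <;> simp

theorem cnt_le {F : ℕ → Option (ℕ × List Bool)}
    (hF : ∀ N, ∑ i ∈ Finset.range N, evR F i ≤ 1) (x : ℕ × List Bool) (N : ℕ) :
    cnt F x N ≤ 2 ^ (x.1 + 1) := by
  have h : (cnt F x N : ℝ) * (1 / 2 : ℝ) ^ (x.1 + 1) ≤ 1 := by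
    rw [← cnt_mul_eq]
    refine le_trans (Finset.sum_le_sum fun i _ => ?_) (hF N)
    split_ifs
    · exact le_rfl
    · exact evR_nonneg F i
  rw [one_div, inv_pow, ← div_eq_mul_inv, div_le_one (by positivity)] at h
  exact_mod_cast h

theorem fiber_sum {F : ℕ → Option (ℕ × List Bool)}
    (hF : ∀ N, ∑ i ∈ Finset.range N, evR F i ≤ 1) (x : ℕ × List Bool) (N : ℕ) :
    ∑ i ∈ Finset.range N, (if F i = some x then reqR (req F) i else 0) =
      powSum (cnt F x N) * (1 / 2 : ℝ) ^ (x.1 + 2) := by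
  induction N with
  | zero => simp [cnt, powSum]
  | succ N ih =>
    rw [Finset.sum_range_succ, ih]
    by_cases h : F N = some x
    · have hc : cnt F x (N + 1) = cnt F x N + 1 := by rw [cnt_succ, if_pos h]
      have hp : powSum (cnt F x N + 1) = powSum (cnt F x N) +
        if 2 ^ Nat.log 2 (cnt F x N + 1) = cnt F x N + 1 then cnt F x N + 1 else 0 := by
        unfold powSum; rw [Finset.sum_range_succ]
      have hle := cnt_le hF x (N + 1)
      rw [if_pos h, hc, hp]
      rw [hc] at hle
      simp only [reqR, req, h, Option.bind_some, hc]
      split_ifs with h2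
      · set k := Nat.log 2 (cnt F x N + 1)
        have hk : k ≤ x.1 + 1 := by
          rw [← h2] at hle
          exact (Nat.pow_le_pow_iff_right (by norm_num)).1 hle
        simp only [Option.map_some, Option.getD_some]
        have e : (1 / 2 : ℝ) ^ (x.1 + 2 - k) = 2 ^ k * (1 / 2 : ℝ) ^ (x.1 + 2) := by
          have : x.1 + 2 = (x.1 + 2 - k) + k := by omega
          conv_rhs => rw [this, pow_add]
          rw [mul_left_comm, ← mul_pow]; norm_num
        have h3 : ((2 : ℝ) ^ k) = cnt F x N + 1 := by exact_mod_cast h2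
        rw [e, h3]; push_cast; ring
      · simp
    · rw [cnt_succ, if_neg h, if_neg h, add_zero]

theorem sum_by_fiber (F : ℕ → Option (ℕ × List Bool)) (N : ℕ) (r : ℕ → ℝ)
    (hr : ∀ i, F i = none → r i = 0) :
    ∑ i ∈ Finset.range N, r i = ∑ x ∈ ((Finset.range N).image F).eraseNone,
      ∑ i ∈ Finset.range N, if F i = some x then r i else 0 := by
  rw [Finset.sum_comm]
  refine Finset.sum_congr rfl fun i hi => ?_
  rcases h : F i with _ | y
  · simp [hr i h]
  · have hy : y ∈ ((Finset.range N).image F).eraseNone := by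
      rw [Finset.mem_eraseNone, ← h]
      exact Finset.mem_image_of_mem F hi
    simp only [Option.some.injEq]
    rw [Finset.sum_ite_eq, if_pos hy]

theorem sum_req_le {F : ℕ → Option (ℕ × List Bool)}
    (hF : ∀ N, ∑ i ∈ Finset.range N, evR F i ≤ 1) (N : ℕ) :
    ∑ i ∈ Finset.range N, reqR (req F) i ≤ 1 := by
  refine le_trans ?_ (hF N)
  rw [sum_by_fiber F N (reqR (req F)) fun i h => by simp [reqR, req, h],
    sum_by_fiber F N (evR F) fun i h => by simp [evR, h]]
  refine Finset.sum_le_sum fun x _ => ?_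
  rw [fiber_sum hF, cnt_mul_eq]
  have : (powSum (cnt F x N) : ℝ) ≤ 2 * cnt F x N := by exact_mod_cast powSum_le _
  have hp : (0 : ℝ) ≤ (1 / 2) ^ (x.1 + 2) := by positivity
  calc _ ≤ (2 * cnt F x N : ℝ) * (1 / 2) ^ (x.1 + 2) := mul_le_mul_of_nonneg_right this hp
    _ = _ := by ring

theorem exists_req (F : ℕ → Option (ℕ × List Bool)) (x : ℕ × List Bool) (N k : ℕ)
    (h : 2 ^ k ≤ cnt F x N) : ∃ i, req F i = some (x.1 + 2 - k, x) := by
  have hex : ∃ N, 2 ^ k ≤ cnt F x N := ⟨N, h⟩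
  have hsp := Nat.find_spec hex
  obtain ⟨i, hi⟩ : ∃ i, Nat.find hex = i + 1 := by
    refine Nat.exists_eq_succ_of_ne_zero fun h => ?_
    rw [h] at hsp
    have : 0 < 2 ^ k := by positivity
    simp [cnt] at hsp
  have hmin := Nat.find_min hex (by omega : i < Nat.find hex)
  rw [hi, cnt_succ] at hsp
  have hFi : F i = some x := by
    by_contra hne
    rw [if_neg hne] at hsp
    exact hmin hsp
  rw [if_pos hFi] at hsp
  have hc : cnt F x (i + 1) = 2 ^ k := by
    rw [cnt_succ, if_pos hFi]; omega
  refine ⟨i, ?_⟩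
  simp [req, hFi, hc, Nat.log_pow]

/-- For any prefix-free machine `C`, `#S_C(n,s) ≤ 2^(n − H(n,s) + O(1))`, where
`H(n,s) = H_U(b(n,s))` for a fixed optimal `U` and recursive pairing bijection `b`. -/
theorem card_S_le (U : List Bool →. List Bool) (hU : OptimalPFM U)
    (b : List Bool × List Bool → List Bool) (hb : Function.Bijective b)
    (hbc : Computable b)
    (C : List Bool →. List Bool) (hC : PFMachine C) :
    ∃ d : ℕ, ∀ (n : ℕ) (s : List Bool),
      ({p : List Bool | p.length ≤ n ∧ s ∈ C p}.ncard : ℝ) ≤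
        2 ^ ((n : ℤ) - ((Hm U (b (strOfNat n, s))).toNat : ℤ) + d) := by
  classical
  obtain ⟨F, P, hF, h1, h2, h3⟩ := exists_events C hC.1
  have hsum := sum_evR_le hC.2 h1 h2
  obtain ⟨D, hD, hDpf, hDr⟩ := kraft_chaitin_s15 (primrec_req hF) (by
    intro i x hx
    obtain ⟨y, hy, hx⟩ := Option.bind_eq_some_iff.1 hx
    have := (h1 i y.1 y.2 hy).1
    split_ifs at hx
    cases hx
    simp only
    omega) (sum_req_le hsum)
  let D' : List Bool →. List Bool := fun q => (D q).map fun x => b (strOfNat x.1, x.2)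
  have hD' : PFMachine D' := by
    constructor
    · refine Partrec.map hD ?_
      exact (hbc.comp (Computable.pair (primrec_strOfNat.to_comp.comp
        (Computable.fst.comp Computable.snd)) (Computable.snd.comp Computable.snd))).to₂
    · exact hDpf
  obtain ⟨d, hd⟩ := hU.2 D' hD'
  refine ⟨d + 4, fun n s => ?_⟩
  set S := {p : List Bool | p.length ≤ n ∧ s ∈ C p} with hS
  rcases Nat.eq_zero_or_pos S.ncard with h0 | hpos
  · rw [h0, Nat.cast_zero]; positivity
  have hfin : S.Finite := Set.finite_of_ncard_pos hpos
  -- the programs in `S` all show up as events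
  have hex : ∀ p : List Bool, ∃ i, p ∈ S → F i = some (n, s) ∧ P i = p := by
    intro p
    by_cases hp : p ∈ S
    · obtain ⟨i, hi⟩ := h3 p n s hp.2 hp.1
      exact ⟨i, fun _ => hi⟩
    · exact ⟨0, fun h => absurd h hp⟩
  choose I hI using hex
  have hcard : S.ncard ≤ cnt F (n, s) (hfin.toFinset.sup I + 1) := by
    rw [Set.ncard_eq_toFinset_card S hfin, cnt_eq_card]
    refine Finset.card_le_card_of_injOn I ?_ ?_
    · intro p hp
      have hp' : p ∈ hfin.toFinset := hp
      have := Finset.le_sup (f := I) hp'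
      simp only [Finset.coe_filter, Finset.mem_range, Set.mem_setOf_eq]
      exact ⟨by omega, (hI p (hfin.mem_toFinset.1 hp')).1⟩
    · intro p hp q hq hpq
      have hp' := (hI p (hfin.mem_toFinset.1 hp)).2
      have hq' := (hI q (hfin.mem_toFinset.1 hq)).2
      rw [← hp', ← hq', hpq]
  set k := Nat.log 2 S.ncard with hk
  have hk1 : 2 ^ k ≤ S.ncard := Nat.pow_log_le_self 2 hpos.ne'
  have hk2 : S.ncard < 2 ^ (k + 1) := Nat.lt_pow_succ_log_self (by norm_num) _
  have hkn : k ≤ n + 1 := by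
    have := (hk1.trans hcard).trans (cnt_le hsum _ _)
    exact (Nat.pow_le_pow_iff_right (by norm_num)).1 this
  obtain ⟨i, hi⟩ := exists_req F (n, s) _ k (hk1.trans hcard)
  obtain ⟨q, hql, hq⟩ := hDr i _ _ hi
  obtain ⟨u, hu, hul⟩ := hd q (b (strOfNat n, s)) (Part.mem_map _ hq)
  have hH : Hm U (b (strOfNat n, s)) ≤ (u.length : ℕ∞) := sInf_le ⟨u, hu, rfl⟩
  have hH' : (Hm U (b (strOfNat n, s))).toNat ≤ u.length := by
    have := ENat.toNat_le_toNat hH (ENat.coe_ne_top _)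
    simpa using this
  calc (S.ncard : ℝ) ≤ 2 ^ (k + 1) := by exact_mod_cast hk2.le
    _ = 2 ^ ((k + 1 : ℕ) : ℤ) := (zpow_natCast _ _).symm
    _ ≤ _ := by
      refine zpow_le_zpow_right₀ (by norm_num) ?_
      simp only at hql
      push_cast
      omega
end
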